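/- arXiv:math/0409278 — 6 statements merged into one kernel-verified Lean document; each statement's English description precedes it below -/
import Mathlib

section
/- Let n be a natural number, Γ a finitely generated subgroup of GL(n, ℂ), and H a subgroup of GL(n, ℂ) that is Zariski-closed, i.e., there is a set S of polynomials in the n² matrix entries with complex coefficients such that an element g ∈ GL(n, ℂ) lies in H if and only if every polynomial in S vanishes when evaluated at the entries of g. Then H ∩ Γ is separable in Γ. -/
open Matrix

/-- A subgroup `A` of a group `Γ` is separable in `Γ` if for every `γ ∈ Γ` with `γ ∉ A`
there exists a finite-index subgroup `K` of `Γ` with `A ⊆ K` and `γ ∉ K`. -/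
def Subgroup.IsSeparable {G : Type*} [Group G] (H : Subgroup G) : Prop :=
  ∀ g : G, g ∉ H → ∃ K : Subgroup G, K.FiniteIndex ∧ H ≤ K ∧ g ∉ K

theorem Int.isJacobsonRing : IsJacobsonRing ℤ := by
  rw [isJacobsonRing_iff_prime_eq]
  intro P hP
  by_cases hbot : P = ⊥
  · subst hbot
    refine le_antisymm (fun x hx => ?_) Ideal.le_jacobson
    have hu := Ideal.mem_jacobson_bot.1 hx x
    rw [Int.isUnit_iff] at hu
    rw [Ideal.mem_bot]
    rcases hu with h | h <;> nlinarith [sq_nonneg x]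
  · have := hP.isMaximal hbot
    exact Ideal.jacobson_eq_self_of_isMaximal

/-- A field that is a quotient of a finitely generated ring is finite. -/
theorem Field.finite_of_ringHom_surjective {R F : Type*} [CommRing R] [Algebra.FiniteType ℤ R]
    [Field F] (f : R →+* F) (hf : Function.Surjective f) : Finite F := by
  have : Algebra.FiniteType ℤ F := .of_surjective f.toIntAlgHom hf
  have := Int.isJacobsonRing
  have hfin : Module.Finite ℤ F := finite_of_finite_type_of_isJacobsonRing ℤ F
  obtain ⟨p, hp⟩ := CharP.exists F
  rcases eq_or_ne p 0 with rfl | hp0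
  · have : CharZero F := CharP.charP_to_charZero F
    exact absurd (isField_of_isIntegral_of_isField (R := ℤ) (S := F)
      (by simpa using Int.cast_injective) (Field.toIsField F)) Int.not_isField
  · refine Module.finite_of_fg_torsion F fun x => ⟨⟨(p : ℤ), ?_⟩, ?_⟩
    · exact mem_nonZeroDivisors_of_ne_zero (by exact_mod_cast hp0)
    · simp [Submonoid.smul_def]

/-- A nonzero element of a finitely generated domain survives in some finite field. -/
theorem exists_ringHom_finite_field_apply_ne_zero.{u} {R : Type u} [CommRing R] [IsDomain R]
    [Algebra.FiniteType ℤ R] {r : R} (hr : r ≠ 0) :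
    ∃ (F : Type u) (_ : Field F) (_ : Finite F) (φ : R →+* F), φ r ≠ 0 := by
  obtain ⟨L, _, _, _⟩ : ∃ (L : Type u) (_ : CommRing L) (_ : Algebra R L),
      IsLocalization.Away r L := ⟨Localization.Away r, inferInstance, inferInstance, inferInstance⟩
  have : Nontrivial L := (IsLocalization.injective L
    (powers_le_nonZeroDivisors_of_noZeroDivisors hr)).nontrivial
  obtain ⟨m, hm⟩ := Ideal.exists_maximal L
  let _ : Field (L ⧸ m) := Ideal.Quotient.field m
  have : Algebra.FiniteType R L := IsLocalization.finiteType_of_monoid_fg (Submonoid.powers r) L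
  have : Algebra.FiniteType ℤ L := Algebra.FiniteType.trans ‹_› this
  refine ⟨L ⧸ m, inferInstance,
    Field.finite_of_ringHom_surjective (Ideal.Quotient.mk m) Ideal.Quotient.mk_surjective,
    (Ideal.Quotient.mk m).comp (algebraMap R L), ?_⟩
  exact ((IsLocalization.Away.algebraMap_isUnit r).map (Ideal.Quotient.mk m)).ne_zero

/-- The matrices of a finitely generated linear group have entries in a finitely generated
ring. -/
theorem exists_finiteType_subalgebra_entries_mem {G k ι : Type*} [Group G] [Group.FG G]
    [CommRing k] [Fintype ι] [DecidableEq ι] (ρ : G →* Matrix ι ι k) :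
    ∃ R : Subalgebra ℤ k, Algebra.FiniteType ℤ R ∧ ∀ g i j, ρ g i j ∈ R := by
  obtain ⟨T, hT, hTfin⟩ := (Group.fg_iff (G := G)).1 inferInstance
  let X : Set k := ⋃ (i : ι) (j : ι), (fun g => ρ g i j) '' (T ∪ T⁻¹)
  have hX : X.Finite := Set.finite_iUnion fun i => Set.finite_iUnion fun j =>
    (hTfin.union hTfin.inv).image _
  have hmem : ∀ g ∈ T ∪ T⁻¹, ∀ i j, ρ g i j ∈ Algebra.adjoin ℤ X := fun g hg i j =>
    Algebra.subset_adjoin (Set.mem_iUnion₂.2 ⟨i, j, g, hg, rfl⟩)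
  refine ⟨Algebra.adjoin ℤ X, .adjoin_of_finite hX, fun g => ?_⟩
  have hg : g ∈ Submonoid.closure (T ∪ T⁻¹) := by
    rw [← Subgroup.closure_toSubmonoid, hT]
    trivial
  induction hg using Submonoid.closure_induction with
  | mem x hx => exact hmem x hx
  | one =>
    intro i j
    rw [map_one, Matrix.one_apply]
    split_ifs
    exacts [one_mem _, zero_mem _]
  | mul x y _ _ hx hy =>
    intro i j
    rw [map_mul, Matrix.mul_apply]
    exact sum_mem fun l _ => mul_mem (hx i l) (hy l j)

/-- The elements `g` such that both `ρ g` and `ρ g⁻¹` preserve the coordinate subspace spanned by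
the basis vectors with index in `s`. -/
def Matrix.coordinateStabilizer {G F ι : Type*} [Group G] [CommRing F] [Fintype ι]
    [DecidableEq ι] (ρ : G →* Matrix ι ι F) (s : Set ι) : Subgroup G where
  carrier := {g | ∀ i ∉ s, ∀ j ∈ s, ρ g i j = 0 ∧ ρ g⁻¹ i j = 0}
  one_mem' := fun i hi j hj => by
    have : i ≠ j := fun h => hi (h ▸ hj)
    simp [this]
  mul_mem' := fun {a b} ha hb i hi j hj => by
    rw [_root_.mul_inv_rev, map_mul, map_mul, Matrix.mul_apply, Matrix.mul_apply]
    constructor <;>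
      refine Finset.sum_eq_zero fun l _ => ?_ <;> by_cases hl : l ∈ s
    · rw [(ha i hi l hl).1, zero_mul]
    · rw [(hb l hl j hj).1, mul_zero]
    · rw [(hb i hi l hl).2, zero_mul]
    · rw [(ha l hl j hj).2, mul_zero]
  inv_mem' := fun {a} ha i hi j hj => by
    rw [inv_inv]
    exact (ha i hi j hj).symm

theorem Matrix.coordinateStabilizer_finiteIndex {G F ι : Type*} [Group G] [CommRing F] [Finite F]
    [Fintype ι] [DecidableEq ι] (ρ : G →* Matrix ι ι F) (s : Set ι) :
    (Matrix.coordinateStabilizer ρ s).FiniteIndex := by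
  have : ρ.toHomUnits.ker.FiniteIndex := inferInstance
  refine Subgroup.finiteIndex_of_le (H := ρ.toHomUnits.ker) ?_
  intro g hg i hi j hj
  have hij : i ≠ j := fun h => hi (h ▸ hj)
  have h1 : ∀ x ∈ ρ.toHomUnits.ker, ρ x = 1 := fun x hx => by
    simpa using congrArg Units.val (MonoidHom.mem_ker.1 hx)
  rw [h1 g hg, h1 g⁻¹ (inv_mem hg)]
  simp [hij]

theorem Matrix.exists_finiteIndex_of_entry_ne_zero {G k ι : Type*} [Group G] [Group.FG G]
    [Field k] [Fintype ι] [DecidableEq ι] (ρ : G →* Matrix ι ι k) (s : Set ι) (A : Subgroup G)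
    (hA : ∀ a ∈ A, ∀ i ∉ s, ∀ j ∈ s, ρ a i j = 0) {γ : G} {i j : ι} (hi : i ∉ s) (hj : j ∈ s)
    (hγ : ρ γ i j ≠ 0) :
    ∃ K : Subgroup G, K.FiniteIndex ∧ A ≤ K ∧ γ ∉ K := by
  obtain ⟨R, hR, hmem⟩ := exists_finiteType_subalgebra_entries_mem ρ
  let ρR : G →* Matrix ι ι R :=
    { toFun := fun g => Matrix.of fun i j => ⟨ρ g i j, hmem g i j⟩
      map_one' := by
        ext i j
        simp only [map_one, Matrix.of_apply, Matrix.one_apply]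
        split_ifs <;> rfl
      map_mul' := fun a b => by
        ext i j
        simp [Matrix.mul_apply] }
  have hr : ρR γ i j ≠ 0 := fun h => hγ (congrArg Subtype.val h)
  obtain ⟨F, _, _, φ, hφ⟩ := exists_ringHom_finite_field_apply_ne_zero hr
  let ρF : G →* Matrix ι ι F := (φ.mapMatrix (m := ι)).toMonoidHom.comp ρR
  have hzero : ∀ a ∈ A, ∀ i ∉ s, ∀ j ∈ s, ρF a i j = 0 := fun a ha i hi j hj => by
    have : ρR a i j = 0 := Subtype.ext (hA a ha i hi j hj)
    change φ (ρR a i j) = 0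
    rw [this, map_zero]
  exact ⟨Matrix.coordinateStabilizer ρF s, Matrix.coordinateStabilizer_finiteIndex ρF s,
    fun a ha i hi j hj => ⟨hzero a ha i hi j hj, hzero a⁻¹ (inv_mem ha) i hi j hj⟩,
    fun h => hφ (h i hi j hj).1⟩

/-- Stabilizers of subspaces in finite-dimensional representations of finitely generated groups
are separable. -/
theorem Representation.exists_finiteIndex_of_notMem {G k V : Type*} [Group G] [Group.FG G]
    [Field k] [AddCommGroup V] [Module k V] [FiniteDimensional k V] (ρ : Representation k G V)
    (W : Submodule k V) (A : Subgroup G) (hA : ∀ a ∈ A, ∀ w ∈ W, ρ a w ∈ W) {γ : G} {w : V}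
    (hw : w ∈ W) (hγ : ρ γ w ∉ W) :
    ∃ K : Subgroup G, K.FiniteIndex ∧ A ≤ K ∧ γ ∉ K := by
  classical
  obtain ⟨t, -, htW, ht⟩ := exists_linearIndependent k (W : Set V)
  rw [Submodule.span_eq] at htW
  have ht' : LinearIndepOn k id t := ht
  let b := Module.Basis.extend ht'
  have := Module.Finite.finite_basis b
  let _ := Fintype.ofFinite (ht'.extend (Set.subset_univ t))
  let s : Set (ht'.extend (Set.subset_univ t)) := {i | (i : V) ∈ t}
  have hs : Submodule.span k (b '' s) = W := by
    rw [← htW]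
    congr 1
    ext v
    simp only [b, Module.Basis.coe_extend, Set.mem_image, s, Set.mem_ofPred_eq]
    exact ⟨fun ⟨i, hi, h⟩ => h ▸ hi, fun h => ⟨⟨v, ht'.subset_extend _ h⟩, h, rfl⟩⟩
  have hW : ∀ v, v ∈ W ↔ ∀ i ∉ s, b.repr v i = 0 := fun v => by
    rw [← hs, Module.Basis.mem_span_image]
    simp only [Set.subset_def, Finset.mem_coe, Finsupp.mem_support_iff]
    exact forall_congr' fun i => not_imp_comm
  have hbW : ∀ j ∈ s, b j ∈ W := fun j hj => hs ▸ Submodule.subset_span ⟨j, hj, rfl⟩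
  let M : G →* Matrix _ _ k := (LinearMap.toMatrixAlgEquiv b).toAlgHom.toRingHom.toMonoidHom.comp ρ
  have hM : ∀ g i j, M g i j = b.repr (ρ g (b j)) i := fun g i j =>
    LinearMap.toMatrixAlgEquiv_apply b (ρ g) i j
  obtain ⟨j, hj, hjγ⟩ : ∃ j ∈ s, ρ γ (b j) ∉ W := by
    by_contra! h
    have hle : Submodule.span k (b '' s) ≤ W.comap (ρ γ) :=
      Submodule.span_le.2 (by rintro _ ⟨j, hj, rfl⟩; exact h j hj)
    exact hγ (hle (hs ▸ hw))
  rw [hW] at hjγ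
  push Not at hjγ
  obtain ⟨i, hi, hij⟩ := hjγ
  refine Matrix.exists_finiteIndex_of_entry_ne_zero M s A (fun a ha i hi j hj => ?_) hi hj
    (hM γ i j ▸ hij)
  rw [hM]
  exact (hW _).1 (hA a ha _ (hbW j hj)) i hi

/-- Right translation of functions on a group. -/
def rightTranslation (k G : Type*) [CommSemiring k] [Group G] : G →* ((G → k) →ₐ[k] (G → k)) where
  toFun g := AlgHom.pi fun x => Pi.evalAlgHom k _ (x * g)
  map_one' := by ext f x; simp
  map_mul' a b := by ext f x; simp [mul_assoc]

@[simp]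
theorem rightTranslation_apply {k G : Type*} [CommSemiring k] [Group G] (g : G) (f : G → k)
    (x : G) : rightTranslation k G g f x = f (x * g) := rfl

/-- A subgroup is separated from a point outside it by a function which vanishes on the subgroup
and lies in a finite-dimensional translation invariant space. -/
theorem exists_finiteIndex_of_function {G k : Type*} [Group G] [Group.FG G] [Field k]
    (V : Submodule k (G → k)) [FiniteDimensional k V]
    (hV : ∀ g, ∀ f ∈ V, rightTranslation k G g f ∈ V) (A : Subgroup G) {f : G → k} (hf : f ∈ V)
    (hfA : ∀ a ∈ A, f a = 0) {γ : G} (hγ : f γ ≠ 0) :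
    ∃ K : Subgroup G, K.FiniteIndex ∧ A ≤ K ∧ γ ∉ K := by
  let ρ : Representation k G V :=
    { toFun := fun g => (rightTranslation k G g).toLinearMap.restrict (hV g)
      map_one' := by ext f x; simp
      map_mul' := fun a b => by
        ext f x
        change (f : G → k) (x * (a * b)) = (f : G → k) (x * a * b)
        rw [mul_assoc] }
  have hρ : ∀ g (v : V) x, (ρ g v : G → k) x = (v : G → k) (x * g) := fun _ _ _ => rfl
  let W : Submodule k V :=
    { carrier := {v | ∀ a ∈ A, (v : G → k) a = 0}
      zero_mem' := fun _ _ => rfl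
      add_mem' := fun {v w} hv hw a ha => by simp [hv a ha, hw a ha]
      smul_mem' := fun c v hv a ha => by simp [hv a ha] }
  refine ρ.exists_finiteIndex_of_notMem W A (fun a ha w hw x hx => ?_) (γ := γ) (w := ⟨f, hf⟩)
    hfA fun h => hγ ?_
  · rw [hρ]
    exact hw _ (mul_mem hx ha)
  · simpa [hρ] using h 1 (one_mem A)

/-- Polynomial functions in the matrix entries lie in finite-dimensional translation invariant
spaces of functions. -/
theorem exists_finiteDimensional_rightTranslation_invariant {G k ι : Type*} [Group G] [Field k]
    [Fintype ι] [DecidableEq ι] (ρ : G →* Matrix ι ι k) (P : MvPolynomial (ι × ι) k) :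
    ∃ V : Submodule k (G → k), FiniteDimensional k V ∧
      (∀ g, ∀ f ∈ V, rightTranslation k G g f ∈ V) ∧
      (fun g => MvPolynomial.eval (fun ij : ι × ι => ρ g ij.1 ij.2) P) ∈ V := by
  let c : ι × ι → G → k := fun ij g => ρ g ij.1 ij.2
  let U : Submodule k (G → k) := Submodule.span k (insert 1 (Set.range c))
  have h1 : 1 ≤ U := by
    rw [Submodule.one_le]
    exact Submodule.subset_span (Set.mem_insert _ _)
  have hc : ∀ ij, c ij ∈ U := fun ij =>
    Submodule.subset_span (Set.mem_insert_of_mem _ ⟨ij, rfl⟩)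
  have hU : ∀ g, U.map (rightTranslation k G g).toLinearMap ≤ U := fun g => by
    rw [Submodule.map_le_iff_le_comap, Submodule.span_le]
    rintro _ (rfl | ⟨⟨i, j⟩, rfl⟩)
    · exact h1 (by simp)
    · have : rightTranslation k G g (c (i, j)) = ∑ l, ρ g l j • c (i, l) := by
        ext x
        simp [c, Matrix.mul_apply, mul_comm]
      change rightTranslation k G g (c (i, j)) ∈ U
      rw [this]
      exact sum_mem fun l _ => U.smul_mem _ (hc _)
  have hfg : U.FG := Submodule.fg_span ((Set.finite_range c).insert 1)
  have hP : ∃ d, MvPolynomial.aeval c P ∈ U ^ d := by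
    induction P using MvPolynomial.induction_on with
    | C a =>
      refine ⟨0, ?_⟩
      rw [Submodule.pow_zero, MvPolynomial.aeval_C]
      exact Submodule.algebraMap_mem a
    | add p q hp hq =>
      obtain ⟨d, hd⟩ := hp
      obtain ⟨e, he⟩ := hq
      refine ⟨max d e, ?_⟩
      rw [map_add]
      exact add_mem (pow_le_pow_right' h1 (le_max_left d e) hd)
        (pow_le_pow_right' h1 (le_max_right d e) he)
    | mul_X p ij hp =>
      obtain ⟨d, hd⟩ := hp
      refine ⟨d + 1, ?_⟩
      rw [map_mul, MvPolynomial.aeval_X, pow_succ]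
      exact Submodule.mul_mem_mul hd (hc ij)
  obtain ⟨d, hd⟩ := hP
  refine ⟨U ^ d, Module.Finite.iff_fg.2 (hfg.pow d), fun g f hf => ?_, ?_⟩
  · have hle : (U ^ d).map (rightTranslation k G g).toLinearMap ≤ U ^ d := by
      rw [Submodule.map_pow]
      exact pow_le_pow_left' (hU g) d
    exact hle ⟨f, hf, rfl⟩
  · convert hd using 1
    ext g
    change _ = Pi.evalAlgHom k (fun _ : G => k) g (MvPolynomial.aeval c P)
    rw [← AlgHom.comp_apply, MvPolynomial.comp_aeval, MvPolynomial.aeval_eq_eval]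
    rfl

theorem stmt6 (n : ℕ) (Γ : Subgroup (GL (Fin n) ℂ)) (hΓ : Γ.FG)
    (H : Subgroup (GL (Fin n) ℂ))
    (S : Set (MvPolynomial (Fin n × Fin n) ℂ))
    (hH : ∀ g : GL (Fin n) ℂ, g ∈ H ↔
      ∀ P ∈ S, MvPolynomial.eval
        (fun ij : Fin n × Fin n => (g : Matrix (Fin n) (Fin n) ℂ) ij.1 ij.2) P = 0) :
    ((H ⊓ Γ).subgroupOf Γ).IsSeparable := by
  intro γ hγ
  have : Group.FG Γ := (Group.fg_iff_subgroup_fg Γ).2 hΓ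
  have hγH : (γ : GL (Fin n) ℂ) ∉ H := fun h => hγ (Subgroup.mem_subgroupOf.2 ⟨h, γ.2⟩)
  rw [hH] at hγH
  push Not at hγH
  obtain ⟨P, hPS, hPγ⟩ := hγH
  obtain ⟨V, _, hV, hPV⟩ := exists_finiteDimensional_rightTranslation_invariant
    ((Units.coeHom (Matrix (Fin n) (Fin n) ℂ)).comp Γ.subtype) P
  exact exists_finiteIndex_of_function V hV _ hPV
    (fun a ha => (hH a).1 (Subgroup.mem_inf.1 (Subgroup.mem_subgroupOf.1 ha)).1 P hPS) hPγ
end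

section
/- Let k be a number field with ring of integers O_k, let σ : k → ℂ be a field embedding, and let m be a natural number. Let H be a solvable subgroup of GL(m, ℂ) that is Zariski-closed and defined over k: there is a set S of polynomials in the m² matrix entries with coefficients in σ(k) such that g ∈ GL(m, ℂ) lies in H if and only if every polynomial of S vanishes at the entries of g. Let H_{O_k} denote the group of those g ∈ GL(m, O_k) whose image under (entrywise application of) σ lies in H. For a nonzero ideal 𝔭 of O_k, let K_{H,𝔭} denote the congruence kernel, i.e., the subgroup of all g ∈ H_{O_k} that reduce to the identity matrix under the entrywise reduction map O_k → O_k/𝔭. Then every finite-index subgroup of H_{O_k} contains K_{H,𝔭} for some nonzero ideal 𝔭 of O_k. -/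
open NumberField

theorem not_tendsto_of_injective_mul {α β : Type*} (f : α → ℕ) (g : β → ℕ)
    (hf : ∀ a, 0 < f a) (hffin : ∀ x : ℝ, {a | (f a : ℝ) ≤ x}.Finite)
    (hgfin : ∀ x : ℝ, {b | (g b : ℝ) ≤ x}.Finite)
    (φ : α × α → β) (hφ : Function.Injective φ) (hg : ∀ a, g (φ a) = f a.1 * f a.2)
    {δ ε : ℝ} (hδ : 0 < δ)
    (hlim : Filter.Tendsto (fun x : ℝ ↦ (Nat.card {a // (f a : ℝ) ≤ x} : ℝ) / x)
      Filter.atTop (nhds δ))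
    (hlim' : Filter.Tendsto (fun x : ℝ ↦ (Nat.card {b // (g b : ℝ) ≤ x} : ℝ) / x)
      Filter.atTop (nhds ε)) : False := by
  classical
  have h1 : ∀ᶠ x : ℝ in Filter.atTop, δ / 2 * x ≤ Nat.card {a // (f a : ℝ) ≤ x} := by
    filter_upwards [hlim.eventually_const_lt (half_lt_self hδ), Filter.eventually_gt_atTop 0]
      with x hx hx0
    exact ((lt_div_iff₀ hx0).1 hx).le
  have h2 : ∀ᶠ x : ℝ in Filter.atTop, (Nat.card {b // (g b : ℝ) ≤ x} : ℝ) ≤ (ε + 1) * x := by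
    filter_upwards [hlim'.eventually_lt_const (lt_add_one ε), Filter.eventually_gt_atTop 0]
      with x hx hx0
    exact ((div_lt_iff₀ hx0).1 hx).le
  have hsum : Summable fun a ↦ (1 : ℝ) / f a := by
    refine summable_of_sum_le (c := (ε + 1) / (δ / 2)) (fun a ↦ by positivity) fun S ↦ ?_
    have h3 : ∀ᶠ x : ℝ in Filter.atTop, ∀ a ∈ S,
        δ / 2 * (x / f a) ≤ Nat.card {b // (f b : ℝ) ≤ x / f a} := by
      rw [Filter.eventually_all_finset]
      intro a _
      exact (Filter.tendsto_id.atTop_div_const (by exact_mod_cast hf a)).eventually h1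
    obtain ⟨x, hx1, hx2, hx0⟩ := (h3.and (h2.and (Filter.eventually_gt_atTop 0))).exists
    have hle : ∑ a ∈ S, Nat.card {b // (f b : ℝ) ≤ x / f a} ≤ Nat.card {b // (g b : ℝ) ≤ x} := by
      have hfin := hgfin x
      have : ∀ y, Finite {b // (f b : ℝ) ≤ y} := fun y ↦ (hffin y).to_subtype
      have : Finite {b // (g b : ℝ) ≤ x} := hfin.to_subtype
      have e : ∑ a ∈ S, Nat.card {b // (f b : ℝ) ≤ x / f a} =
          Nat.card (Σ a : S, {b // (f b : ℝ) ≤ x / f a}) := by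
        rw [Nat.card_sigma, ← Finset.sum_coe_sort S]
      rw [e]
      refine Nat.card_le_card_of_injective
        (fun p ↦ ⟨φ (p.1, p.2.1), ?_⟩) ?_
      · rw [hg]
        have := p.2.2
        rw [le_div_iff₀ (by exact_mod_cast hf _)] at this
        push_cast
        linarith
      · rintro ⟨⟨a, ha⟩, ⟨b, hb⟩⟩ ⟨⟨a', ha'⟩, ⟨b', hb'⟩⟩ h
        have := hφ (congrArg Subtype.val h)
        simp only [Prod.mk.injEq] at this
        obtain ⟨rfl, rfl⟩ := this
        rfl
    have hle' : ∑ a ∈ S, δ / 2 * (x / f a) ≤ (ε + 1) * x := by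
      refine (Finset.sum_le_sum hx1).trans (le_trans ?_ hx2)
      exact_mod_cast hle
    rw [le_div_iff₀ (by positivity)]
    have : ∑ a ∈ S, δ / 2 * (x / f a) = (∑ a ∈ S, (1 : ℝ) / f a) * (δ / 2) * x := by
      rw [Finset.sum_mul, Finset.sum_mul]
      exact Finset.sum_congr rfl fun a _ ↦ by ring
    rw [this] at hle'
    exact le_of_mul_le_mul_right hle' hx0
  obtain ⟨S, hS⟩ := summable_iff_vanishing_norm.1 hsum (δ / 4) (by positivity)
  obtain ⟨x, hx1, hx2, hx0⟩ := (h1.and ((Filter.eventually_gt_atTop (S.card / (δ / 4) : ℝ)).and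
    (Filter.eventually_gt_atTop 0))).exists
  have hx2 := (div_lt_iff₀ (by positivity)).1 hx2
  have hcard : Nat.card {a // (f a : ℝ) ≤ x} = (hffin x).toFinset.card := by
    exact Nat.card_eq_card_finite_toFinset (hffin x)
  set F := (hffin x).toFinset
  have hF : ((F \ S).card : ℝ) ≤ δ / 4 * x := by
    have h4 := hS (F \ S) Finset.sdiff_disjoint
    rw [Real.norm_of_nonneg (Finset.sum_nonneg fun _ _ ↦ by positivity)] at h4
    have h5 : ∑ a ∈ F \ S, (1 / x : ℝ) ≤ ∑ a ∈ F \ S, (1 : ℝ) / f a := by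
      refine Finset.sum_le_sum fun a ha ↦ ?_
      have : (f a : ℝ) ≤ x := by simpa [F] using (Finset.mem_sdiff.1 ha).1
      exact one_div_le_one_div_of_le (by exact_mod_cast hf a) this
    rw [Finset.sum_const, nsmul_eq_mul] at h5
    have h6 := h5.trans h4.le
    rw [mul_one_div, div_le_iff₀ hx0] at h6
    exact h6
  have hF' : (F.card : ℝ) ≤ (F \ S).card + S.card := by
    exact_mod_cast Finset.card_le_card_sdiff_add_card
  rw [hcard] at hx1
  nlinarith

theorem exists_tendsto_card_ideal_not_dvd (K : Type*) [Field K] [NumberField K]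
    (T : Finset (Ideal (𝓞 K))) (hT : ∀ p ∈ T, Prime p) :
    ∃ δ : ℝ, 0 < δ ∧ Filter.Tendsto (fun x : ℝ ↦ (Nat.card {I : Ideal (𝓞 K) //
      (I ≠ ⊥ ∧ ∀ p ∈ T, ¬ p ∣ I) ∧ (Ideal.absNorm I : ℝ) ≤ x} : ℝ) / x)
      Filter.atTop (nhds δ) := by
  classical
  induction T using Finset.induction_on with
  | empty =>
    refine ⟨_, dedekindZeta_residue_pos K, ?_⟩
    rw [dedekindZeta_residue_def]
    refine (Ideal.tendsto_norm_le_div_atTop₀ K).congr fun x ↦ ?_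
    congr 2
    refine Nat.card_congr ⟨fun I ↦ ⟨I.1.1, by simpa using nonZeroDivisors.ne_zero I.1.2, I.2⟩,
      fun I ↦ ⟨⟨I.1, mem_nonZeroDivisors_iff_ne_zero.2 I.2.1.1⟩, I.2.2⟩, fun _ ↦ rfl, fun _ ↦ rfl⟩
  | insert p T hpT ih =>
    obtain ⟨δ, hδ, hlim⟩ := ih fun q hq ↦ hT q (Finset.mem_insert_of_mem hq)
    have hp : Prime p := hT p (Finset.mem_insert_self _ _)
    set P := (Ideal.absNorm p : ℝ)
    have hP0 : Ideal.absNorm p ≠ 0 := Ideal.absNorm_eq_zero_iff.not.2 hp.ne_zero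
    have hP1 : Ideal.absNorm p ≠ 1 := Ideal.absNorm_eq_one_iff.not.2
      fun h ↦ hp.not_isUnit (by simp [h])
    have hP : 1 < P := by
      have : 1 < Ideal.absNorm p := by omega
      simpa only [P, Nat.one_lt_cast] using this
    refine ⟨δ - δ / P, sub_pos.2 (div_lt_self hδ hP), ?_⟩
    have hlim2 := (hlim.comp (Filter.tendsto_id.atTop_div_const (zero_lt_one.trans hP))).div_const P
    refine (hlim.sub hlim2).congr' ?_
    filter_upwards [Filter.eventually_gt_atTop 0] with x hx
    have hfin : ∀ y : ℝ, Finite {I : Ideal (𝓞 K) //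
        (I ≠ ⊥ ∧ ∀ p ∈ T, ¬ p ∣ I) ∧ (Ideal.absNorm I : ℝ) ≤ y} := by
      intro y
      refine Set.Finite.subset (s := {I | Ideal.absNorm I ≤ ⌊y⌋₊})
        (Ideal.finite_setOfPred_absNorm_le _) ?_
      rintro I ⟨-, hI⟩
      exact Nat.le_floor hI
    have key : Nat.card {I : Ideal (𝓞 K) //
        (I ≠ ⊥ ∧ ∀ p ∈ T, ¬ p ∣ I) ∧ (Ideal.absNorm I : ℝ) ≤ x} =
        Nat.card {I : Ideal (𝓞 K) //
          (I ≠ ⊥ ∧ ∀ q ∈ insert p T, ¬ q ∣ I) ∧ (Ideal.absNorm I : ℝ) ≤ x} +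
        Nat.card {I : Ideal (𝓞 K) //
          (I ≠ ⊥ ∧ ∀ p ∈ T, ¬ p ∣ I) ∧ (Ideal.absNorm I : ℝ) ≤ x / P} := by
      have := hfin x
      have := hfin (x / P)
      have : Finite {I : Ideal (𝓞 K) //
          (I ≠ ⊥ ∧ ∀ q ∈ insert p T, ¬ q ∣ I) ∧ (Ideal.absNorm I : ℝ) ≤ x} :=
        Set.Finite.subset (s := {I : Ideal (𝓞 K) |
          (I ≠ ⊥ ∧ ∀ p ∈ T, ¬ p ∣ I) ∧ (Ideal.absNorm I : ℝ) ≤ x}) (hfin x)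
          fun I hI ↦ ⟨⟨hI.1.1, fun q hq ↦ hI.1.2 q (Finset.mem_insert_of_mem hq)⟩, hI.2⟩
      have hmul : ∀ J : Ideal (𝓞 K), (∀ q ∈ T, ¬ q ∣ J) → ∀ q ∈ T, ¬ q ∣ p * J := by
        intro J hJ q hq hdvd
        have hq' := hT q (Finset.mem_insert_of_mem hq)
        rcases hq'.dvd_or_dvd hdvd with h | h
        · exact hpT (associated_iff_eq.1 (hq'.associated_of_dvd hp h) ▸ hq)
        · exact hJ q hq h
      have hmul' : ∀ J : Ideal (𝓞 K), (Ideal.absNorm J : ℝ) ≤ x / P →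
          (Ideal.absNorm (p * J) : ℝ) ≤ x := by
        intro J hJ
        rw [le_div_iff₀ (by positivity)] at hJ
        rw [map_mul, Nat.cast_mul, mul_comm]
        exact hJ
      rw [← Nat.card_sum]
      refine (Nat.card_congr (Equiv.ofBijective (Sum.elim
        (fun I ↦ ⟨I.1, ⟨I.2.1.1, fun q hq ↦ I.2.1.2 q (Finset.mem_insert_of_mem hq)⟩, I.2.2⟩)
        (fun J ↦ ⟨p * J.1, ⟨mul_ne_zero hp.ne_zero J.2.1.1, hmul J.1 J.2.1.2⟩, hmul' J.1 J.2.2⟩))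
        ⟨?_, ?_⟩)).symm
      · rintro (I | J) (I' | J') h <;> simp only [Sum.elim_inl, Sum.elim_inr, Subtype.mk.injEq] at h
        · rw [Subtype.ext h]
        · exact absurd ⟨_, h⟩ (I.2.1.2 p (Finset.mem_insert_self _ _))
        · exact absurd ⟨_, h.symm⟩ (I'.2.1.2 p (Finset.mem_insert_self _ _))
        · rw [Subtype.ext (mul_left_cancel₀ hp.ne_zero h)]
      · rintro ⟨I, ⟨hI0, hI⟩, hIx⟩
        by_cases hd : p ∣ I
        · obtain ⟨J, rfl⟩ := hd
          refine ⟨Sum.inr ⟨J, ⟨right_ne_zero_of_mul hI0, fun q hq h ↦ hI q hq (h.mul_left p)⟩, ?_⟩, rfl⟩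
          rw [le_div_iff₀ (by positivity)]
          rw [map_mul] at hIx; push_cast at hIx; linarith
        · refine ⟨Sum.inl ⟨I, ⟨hI0, fun q hq ↦ ?_⟩, hIx⟩, rfl⟩
          rcases Finset.mem_insert.1 hq with rfl | h
          · exact hd
          · exact hI q h
    rw [key]
    simp only [Function.comp, id]
    rw [div_div, div_mul_cancel₀ x (zero_lt_one.trans hP).ne', ← sub_div, Nat.cast_add,
      add_sub_cancel_right]

theorem finite_setOf_absNorm_le (K : Type*) [Field K] [NumberField K] (P : Ideal (𝓞 K) → Prop)
    (x : ℝ) : {I : {I // P I} | (Ideal.absNorm I.1 : ℝ) ≤ x}.Finite := by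
  refine Set.Finite.of_finite_image (f := Subtype.val)
    ((Ideal.finite_setOfPred_absNorm_le ⌊x⌋₊).subset ?_) Subtype.val_injective.injOn
  rintro _ ⟨I, hI, rfl⟩
  exact Nat.le_floor hI

open UniqueFactorizationMonoid in
theorem exists_prime_not_split (K M : Type*) [Field K] [NumberField K] [Field M] [NumberField M]
    [Algebra K M] (T : Finset (Ideal (𝓞 K))) :
    ∃ p : Ideal (𝓞 K), Prime p ∧ p ∉ T ∧ ∀ Q₁ Q₂ : Ideal (𝓞 M), Prime Q₁ → Prime Q₂ →
      Q₁.under (𝓞 K) = p → Q₂.under (𝓞 K) = p → Ideal.absNorm Q₁ = Ideal.absNorm p →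
      Ideal.absNorm Q₂ = Ideal.absNorm p → Q₁ = Q₂ := by
  classical
  by_contra! hcon
  choose! q₁ q₂ hq₁ hq₂ hu₁ hu₂ hn₁ hn₂ hne using hcon
  set T' := T.filter Prime
  have hT' : ∀ p ∈ T', Prime p := fun p hp ↦ (Finset.mem_filter.1 hp).2
  obtain ⟨δ, hδ, hlim⟩ := exists_tendsto_card_ideal_not_dvd K T' hT'
  obtain ⟨ε, hε, hlim'⟩ := exists_tendsto_card_ideal_not_dvd M ∅ (by simp)
  have good : ∀ I : Ideal (𝓞 K), (I ≠ ⊥ ∧ ∀ p ∈ T', ¬ p ∣ I) → ∀ p ∈ normalizedFactors I,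
      Prime p ∧ p ∉ T := fun I hI p hp ↦
    ⟨prime_of_normalized_factor p hp, fun h ↦ hI.2 p
      (Finset.mem_filter.2 ⟨h, prime_of_normalized_factor p hp⟩) (dvd_of_mem_normalizedFactors hp)⟩
  have nf : ∀ s : Multiset (Ideal (𝓞 M)), (∀ Q ∈ s, Prime Q) → normalizedFactors s.prod = s :=
    fun s hs ↦ normalizedFactors_prod_of_prime hs
  have hprime : ∀ A B : Multiset (Ideal (𝓞 K)), (∀ p ∈ A, Prime p ∧ p ∉ T) →
      (∀ p ∈ B, Prime p ∧ p ∉ T) → ∀ Q ∈ A.map q₁ + B.map q₂, Prime Q := by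
    intro A B hA hB Q hQ
    rcases Multiset.mem_add.1 hQ with h | h
    · obtain ⟨p, hp, rfl⟩ := Multiset.mem_map.1 h
      exact hq₁ p (hA p hp).1 (hA p hp).2
    · obtain ⟨p, hp, rfl⟩ := Multiset.mem_map.1 h
      exact hq₂ p (hB p hp).1 (hB p hp).2
  have inj₁ : ∀ A B : Multiset (Ideal (𝓞 K)), (∀ p ∈ A, Prime p ∧ p ∉ T) →
      (∀ p ∈ B, Prime p ∧ p ∉ T) →
      ((A.map q₁ + B.map q₂).filter fun Q ↦ Q = q₁ (Q.under (𝓞 K))).map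
        (fun Q ↦ Q.under (𝓞 K)) = A := by
    intro A B hA hB
    rw [Multiset.filter_add, Multiset.filter_eq_self.2, Multiset.filter_eq_nil.2, add_zero,
      Multiset.map_map]
    · conv_rhs => rw [← Multiset.map_id A]
      exact Multiset.map_congr rfl fun p hp ↦ hu₁ p (hA p hp).1 (hA p hp).2
    · intro Q hQ
      obtain ⟨p, hp, rfl⟩ := Multiset.mem_map.1 hQ
      rw [hu₂ p (hB p hp).1 (hB p hp).2]
      exact (hne p (hB p hp).1 (hB p hp).2).symm
    · intro Q hQ
      obtain ⟨p, hp, rfl⟩ := Multiset.mem_map.1 hQ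
      rw [hu₁ p (hA p hp).1 (hA p hp).2]
  have inj₂ : ∀ A B : Multiset (Ideal (𝓞 K)), (∀ p ∈ A, Prime p ∧ p ∉ T) →
      (∀ p ∈ B, Prime p ∧ p ∉ T) →
      ((A.map q₁ + B.map q₂).filter fun Q ↦ Q = q₂ (Q.under (𝓞 K))).map
        (fun Q ↦ Q.under (𝓞 K)) = B := by
    intro A B hA hB
    rw [Multiset.filter_add, Multiset.filter_eq_nil.2, Multiset.filter_eq_self.2, zero_add,
      Multiset.map_map]
    · conv_rhs => rw [← Multiset.map_id B]
      exact Multiset.map_congr rfl fun p hp ↦ hu₂ p (hB p hp).1 (hB p hp).2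
    · intro Q hQ
      obtain ⟨p, hp, rfl⟩ := Multiset.mem_map.1 hQ
      rw [hu₂ p (hB p hp).1 (hB p hp).2]
    · intro Q hQ
      obtain ⟨p, hp, rfl⟩ := Multiset.mem_map.1 hQ
      rw [hu₁ p (hA p hp).1 (hA p hp).2]
      exact hne p (hA p hp).1 (hA p hp).2
  have norm_map : ∀ (q : Ideal (𝓞 K) → Ideal (𝓞 M)),
      (∀ p, Prime p → p ∉ T → Ideal.absNorm (q p) = Ideal.absNorm p) →
      ∀ I : Ideal (𝓞 K), (I ≠ ⊥ ∧ ∀ p ∈ T', ¬ p ∣ I) →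
      Ideal.absNorm ((normalizedFactors I).map q).prod = Ideal.absNorm I := by
    intro q hq I hI
    conv_rhs => rw [← Ideal.prod_normalizedFactors_eq_self hI.1]
    rw [map_multiset_prod, map_multiset_prod, Multiset.map_map]
    exact congrArg _ (Multiset.map_congr rfl fun p hp ↦ hq p (good I hI p hp).1 (good I hI p hp).2)
  refine not_tendsto_of_injective_mul
    (α := {I : Ideal (𝓞 K) // I ≠ ⊥ ∧ ∀ p ∈ T', ¬ p ∣ I})
    (β := {I : Ideal (𝓞 M) // I ≠ ⊥ ∧ ∀ p ∈ (∅ : Finset (Ideal (𝓞 M))), ¬ p ∣ I})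
    (fun I ↦ Ideal.absNorm I.1) (fun I ↦ Ideal.absNorm I.1)
    (fun I ↦ Nat.pos_of_ne_zero (Ideal.absNorm_eq_zero_iff.not.2 I.2.1))
    (finite_setOf_absNorm_le K _) (finite_setOf_absNorm_le M _)
    (fun I ↦ ⟨((normalizedFactors I.1.1).map q₁ + (normalizedFactors I.2.1).map q₂).prod,
      Multiset.prod_ne_zero fun h ↦
        (hprime _ _ (good _ I.1.2) (good _ I.2.2) _ h).ne_zero rfl, by simp⟩)
    ?_ ?_ (δ := δ) (ε := ε) hδ ?_ ?_
  · rintro ⟨⟨I, hI⟩, ⟨J, hJ⟩⟩ ⟨⟨I', hI'⟩, ⟨J', hJ'⟩⟩ h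
    have h' := congrArg normalizedFactors (congrArg Subtype.val h)
    simp only at h'
    rw [nf _ (hprime _ _ (good I hI) (good J hJ)), nf _ (hprime _ _ (good I' hI') (good J' hJ'))]
      at h'
    have e₁ := inj₁ _ _ (good I hI) (good J hJ)
    rw [h', inj₁ _ _ (good I' hI') (good J' hJ')] at e₁
    have e₂ := inj₂ _ _ (good I hI) (good J hJ)
    rw [h', inj₂ _ _ (good I' hI') (good J' hJ')] at e₂
    simp only [Prod.mk.injEq, Subtype.mk.injEq]
    rw [← Ideal.prod_normalizedFactors_eq_self hI.1, ← Ideal.prod_normalizedFactors_eq_self hJ.1,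
      ← e₁, ← e₂, Ideal.prod_normalizedFactors_eq_self hI'.1,
      Ideal.prod_normalizedFactors_eq_self hJ'.1]
    exact ⟨rfl, rfl⟩
  · intro I
    simp only [Multiset.prod_add, map_mul]
    rw [norm_map q₁ hn₁ _ I.1.2, norm_map q₂ hn₂ _ I.2.2]
  · exact hlim.congr fun x ↦ by
      rw [← Nat.card_congr (Equiv.subtypeSubtypeEquivSubtypeInter _ _)]
  · exact hlim'.congr fun x ↦ by
      rw [← Nat.card_congr (Equiv.subtypeSubtypeEquivSubtypeInter _ _)]

open Polynomial in
open scoped Pointwise in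
theorem exists_pow_eq_of_forall_prime {K : Type*} [Field K] [NumberField K] {N : ℕ} (hN : 0 < N)
    {ζ : 𝓞 K} (hζ : IsPrimitiveRoot ζ N) (u : 𝓞 K) (hu : IsUnit u)
    (h : ∀ p : Ideal (𝓞 K), Prime p → (N : 𝓞 K) ∉ p → ∃ a : 𝓞 K, a ^ N - u ∈ p) :
    ∃ w : K, w ^ N = u := by
  have : NeZero N := ⟨hN.ne'⟩
  let f : K[X] := X ^ N - C (u : K)
  have hf0 : f ≠ 0 := X_pow_sub_C_ne_zero hN _
  let M := f.SplittingField
  have : NumberField M :=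
    { to_charZero := charZero_of_injective_algebraMap (algebraMap K M).injective
      to_finiteDimensional := by
        have : IsScalarTower ℚ K M := IsScalarTower.of_algebraMap_eq' (Subsingleton.elim _ _)
        exact FiniteDimensional.trans ℚ K M }
  have hu0 : (u : K) ≠ 0 := by simpa using hu.ne_zero
  have : IsGalois K M := IsGalois.of_separable_splitting_field (p := f)
    (separable_X_pow_sub_C _ (by exact_mod_cast hN.ne') hu0)
  by_contra hne
  have hspl : (f.map (algebraMap K M)).Splits := SplittingField.splits f
  -- the group is nontrivial
  obtain ⟨σ, hσ⟩ : ∃ σ : Gal(M/K), σ ≠ 1 := by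
    by_contra! hall
    obtain ⟨x, hx⟩ := hspl.exists_eval_eq_zero (by
      rw [degree_map, degree_X_pow_sub_C hN]; exact_mod_cast hN.ne')
    have hx' : x ^ N = algebraMap K M u := by
      simpa [f, sub_eq_zero] using hx
    have : x ∈ (⊥ : IntermediateField K M) :=
      (IsGalois.mem_bot_iff_fixed x).2 fun σ ↦ by simp [hall σ]
    obtain ⟨w, rfl⟩ := IntermediateField.mem_bot.1 this
    exact hne ⟨w, (algebraMap K M).injective (by simpa using hx')⟩
  have hNK : Ideal.span {(N : 𝓞 K)} ≠ ⊥ := by simpa using hN.ne'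
  obtain ⟨p, hp, hpT, hsplit⟩ := exists_prime_not_split K M
    (UniqueFactorizationMonoid.normalizedFactors (Ideal.span {(N : 𝓞 K)})).toFinset
  have hpprime : p.IsPrime := Ideal.isPrime_of_prime hp
  have hpmax : p.IsMaximal := hpprime.isMaximal hp.ne_zero
  have hNp : (N : 𝓞 K) ∉ p := fun hmem ↦ hpT (by
    rw [Multiset.mem_toFinset, Ideal.mem_normalizedFactors_iff hNK]
    exact ⟨hpprime, by simpa [Ideal.span_singleton_le_iff_mem] using hmem⟩)
  obtain ⟨a, ha⟩ := h p hp hNp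
  -- stabilizers of primes above `p` are trivial
  have hstab : ∀ Q : Ideal (𝓞 M), Q.IsPrime → Q.LiesOver p →
      ∀ τ : Gal(M/K), τ • Q = Q → τ = 1 := by
    intro Q hQ hQp τ hτ
    have hNQ : (N : 𝓞 M) ∉ Q := fun hmem ↦ hNp (by
      rw [hQp.over, Ideal.under, Ideal.mem_comap]; simpa using hmem)
    have hroot : ∀ w : 𝓞 M, w ^ N = algebraMap (𝓞 K) (𝓞 M) u → τ • w = w := by
      intro w hw
      have hζM : IsPrimitiveRoot (algebraMap (𝓞 K) (𝓞 M) ζ) N :=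
        hζ.map_of_injective (FaithfulSMul.algebraMap_injective _ _)
      have hprod := hζM.pow_sub_pow_eq_prod_sub_mul w (algebraMap (𝓞 K) (𝓞 M) a) hN
      have hmem : w ^ N - (algebraMap (𝓞 K) (𝓞 M) a) ^ N ∈ Q := by
        rw [hw, ← map_pow, ← neg_sub, neg_mem_iff, ← map_sub]
        rw [hQp.over, Ideal.under, Ideal.mem_comap] at ha
        exact ha
      rw [hprod] at hmem
      obtain ⟨η, hη, hηQ⟩ := (hQ.prod_mem_iff).1 hmem
      rw [mem_nthRootsFinset hN] at hη
      obtain ⟨i, -, rfl⟩ := hζM.eq_pow_of_pow_eq_one hη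
      have h2 : τ • w - (algebraMap (𝓞 K) (𝓞 M) ζ) ^ i * algebraMap (𝓞 K) (𝓞 M) a ∈ Q := by
        have := Ideal.smul_mem_pointwise_smul τ _ _ hηQ
        rwa [hτ, smul_sub, smul_mul', smul_pow', smul_algebraMap, smul_algebraMap] at this
      have h3 : τ • w - w ∈ Q := by
        have := Q.sub_mem h2 hηQ
        simpa using this
      have hwunit : IsUnit w := by
        rw [← isUnit_pow_iff hN.ne', hw]; exact hu.map _
      obtain ⟨v, rfl⟩ := hwunit
      set η : 𝓞 M := (τ • (v : 𝓞 M)) * ((v⁻¹ : (𝓞 M)ˣ) : 𝓞 M) with hηdef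
      have hτv : τ • (v : 𝓞 M) = η * v := by simp [hηdef]
      have hηN : η ^ N = 1 := by
        rw [hηdef, mul_pow, ← smul_pow', hw, smul_algebraMap, ← hw, ← mul_pow]; simp
      have hη1 : η - 1 ∈ Q := by
        have : η - 1 = (τ • (v : 𝓞 M) - v) * ((v⁻¹ : (𝓞 M)ˣ) : 𝓞 M) := by
          rw [sub_mul]; simp [hηdef]
        rw [this]; exact Q.mul_mem_right _ h3
      by_cases hη : η = 1
      · rw [hτv, hη, one_mul]
      · exact absurd (Q.mem_of_dvd (sub_one_dvd_natCast_of_pow_eq_one hηN hη) hη1) hNQ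
    have hroot' : ∀ x : M, x ∈ f.rootSet M → τ x = x := by
      intro x hx
      have hx' : x ^ N = algebraMap K M u := by
        have := (mem_rootSet.1 hx).2
        simpa [f, sub_eq_zero] using this
      have hint : IsIntegral ℤ x := by
        apply IsIntegral.of_pow hN
        rw [hx']
        exact ((RingOfIntegers.isIntegral_coe u).map (Algebra.ofId K M |>.restrictScalars ℤ) :)
      have := hroot ⟨x, hint⟩ (RingOfIntegers.ext hx')
      exact congrArg (algebraMap (𝓞 M) M) this
    have hext : (τ : M →ₐ[K] M) = (1 : Gal(M/K)) :=
      AlgHom.ext_of_adjoin_eq_top (SplittingField.adjoin_rootSet f) hroot'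
    exact AlgEquiv.ext fun x ↦ DFunLike.congr_fun hext x
  have hinert : ∀ Q : Ideal (𝓞 M), Q.IsPrime → Q.LiesOver p → Ideal.absNorm Q = Ideal.absNorm p := by
    intro Q hQ hQp
    have hst : Nat.card (MulAction.stabilizer Gal(M/K) Q) = 1 := by
      rw [Nat.card_eq_one_iff_unique]
      refine ⟨⟨fun a b ↦ Subtype.ext ?_⟩, ⟨1⟩⟩
      rw [hstab Q hQ hQp a a.2, hstab Q hQ hQp b b.2]
    have : Finite (𝓞 K ⧸ p) := Ideal.finiteQuotientOfFreeOfNeBot p hp.ne_zero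
    have := Ideal.card_stabilizer_eq_card_inertia_mul_finrank (G := Gal(M/K)) p Q
    rw [hst] at this
    have h1 := Nat.eq_one_of_mul_eq_one_left this.symm
    have := Ideal.absNorm_pow_inertiaDeg (p := p) (q := Q)
    rw [h1, pow_one] at this
    exact this.symm
  obtain ⟨Q, hQ, hQp⟩ := Ideal.exists_maximal_ideal_liesOver_of_isIntegral (S := 𝓞 M) p
  have hσQ : (σ • Q).IsPrime := inferInstance
  have hσQp : (σ • Q).LiesOver p := inferInstance
  have hQ0 : ∀ Q : Ideal (𝓞 M), Q.IsPrime → Q.LiesOver p → Prime Q := fun Q hQ hQp ↦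
    Ideal.prime_of_isPrime (Ideal.ne_bot_of_liesOver_of_ne_bot hp.ne_zero Q) hQ
  exact hσ (hstab Q hQ.isPrime hQp σ (hsplit _ _ (hQ0 _ hσQ hσQp) (hQ0 _ hQ.isPrime hQp)
    hσQp.over.symm hQp.over.symm (hinert _ hσQ hσQp) (hinert _ hQ.isPrime hQp)))

theorem eq_one_of_sub_one_eq_six_mul {F : Type*} [Field F] [CharZero F] {ζ x : F} {n : ℕ}
    (hn : 0 < n) (hζ : ζ ^ n = 1) (hx : IsIntegral ℤ x) (h : ζ - 1 = 6 * x) : ζ = 1 := by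
  by_contra hne
  have hfin : IsOfFinOrder ζ := isOfFinOrder_iff_pow_eq_one.2 ⟨n, hn, hζ⟩
  set d := orderOf ζ with hd
  have hd1 : d ≠ 1 := fun h ↦ hne (orderOf_eq_one_iff.1 h)
  have hq : d.minFac.Prime := Nat.minFac_prime hd1
  set q := d.minFac with hqdef
  obtain ⟨c, hc⟩ : q ∣ d := Nat.minFac_dvd d
  have hc0 : 0 < c := Nat.pos_of_ne_zero fun h ↦ hfin.orderOf_pos.ne' (by rw [← hd, hc, h, mul_zero])
  have h1 : (ζ ^ c) ^ q = 1 := by rw [← pow_mul, mul_comm, ← hc, hd, pow_orderOf_eq_one]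
  have h2 : ζ ^ c ≠ 1 := fun h ↦ by
    have := Nat.le_of_dvd hc0 (orderOf_dvd_of_pow_eq_one h)
    rw [← hd, hc] at this
    nlinarith [hq.two_le]
  let A := integralClosure ℤ F
  let z : A := ⟨ζ, IsIntegral.of_pow hn (by rw [hζ]; exact isIntegral_one)⟩
  let y : A := ⟨x, hx⟩
  have hzy : (6 : A) ∣ z - 1 := ⟨y, Subtype.ext h⟩
  have hq6 : (6 : A) ∣ (q : A) :=
    (hzy.trans (sub_one_dvd_pow_sub_one z c)).trans
      (sub_one_dvd_natCast_of_pow_eq_one (Subtype.ext h1) fun h ↦ h2 (congrArg Subtype.val h))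
  obtain ⟨⟨w, hw⟩, hqw⟩ := hq6
  have hqw' : (q : F) = 6 * w := congrArg Subtype.val hqw
  have hwq : w = algebraMap ℚ F (q / 6) := by
    simp [hqw']
  rw [hwq] at hw
  have hw' : IsIntegral ℤ (q / 6 : ℚ) :=
    (isIntegral_algebraMap_iff (algebraMap ℚ F).injective).1 hw
  obtain ⟨t, ht⟩ := IsIntegrallyClosed.isIntegral_iff.1 hw'
  have h6 : (q : ℤ) = 6 * t := by
    have : (q : ℚ) = 6 * t := by
      rw [eq_intCast] at ht; rw [ht]; ring
    exact_mod_cast this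
  have h23 : (2 : ℕ) ∣ q ∧ 3 ∣ q := by omega
  have e2 := (Nat.prime_dvd_prime_iff_eq Nat.prime_two hq).1 h23.1
  have e3 := (Nat.prime_dvd_prime_iff_eq Nat.prime_three hq).1 h23.2
  omega

theorem exists_zpow_eq_pow_of_cyclotomic {L L' : Type*} [Field L] [Field L'] [Algebra L L']
    {N : ℕ} [NeZero N] [IsCyclotomicExtension {N} L L'] [CharZero L] {W : ℕ}
    (hW : ∀ ξ : L, IsOfFinOrder ξ → ξ ^ W = 1) {u : L} (hu : u ≠ 0) {w : L'}
    (hw : w ^ N = algebraMap L L' u) : ∃ c : L, c ^ N = u ^ W := by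
  have hN : 0 < N := NeZero.pos N
  have : FiniteDimensional L L' := IsCyclotomicExtension.finiteDimensional {N} L L'
  have := IsCyclotomicExtension.isAbelianGalois {N} L L'
  have hζ := IsCyclotomicExtension.zeta_spec N L L'
  set ζ := IsCyclotomicExtension.zeta N L L'
  have hζ0 : ζ ≠ 0 := hζ.ne_zero hN.ne'
  have hw0 : w ≠ 0 := by
    rintro rfl
    rw [zero_pow hN.ne'] at hw
    exact hu ((algebraMap L L').injective (by rw [← hw, map_zero]))
  have hσζ : ∀ σ : Gal(L'/L), ∃ s : ℕ, σ ζ = ζ ^ s := fun σ ↦ by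
    obtain ⟨i, -, hi⟩ := hζ.eq_pow_of_pow_eq_one (ξ := σ ζ) (by rw [← map_pow, hζ.pow_eq_one, map_one])
    exact ⟨i, hi.symm⟩
  choose s hs using hσζ
  let D : AddSubgroup ℤ :=
    { carrier := {d | ∃ c : L, c ^ N = u ^ d}
      zero_mem' := ⟨1, by simp⟩
      add_mem' := by
        rintro a b ⟨c, hc⟩ ⟨d, hd⟩
        exact ⟨c * d, by rw [mul_pow, hc, hd, zpow_add₀ hu]⟩
      neg_mem' := by
        rintro a ⟨c, hc⟩
        exact ⟨c⁻¹, by rw [inv_pow, hc, zpow_neg]⟩ }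
  have hND : (N : ℤ) ∈ D := ⟨u, by simp⟩
  have hsD : ∀ σ, 1 - (s σ : ℤ) ∈ D := by
    intro σ
    have hfix : ∀ τ : Gal(L'/L), τ (σ w / w ^ s σ) = σ w / w ^ s σ := by
      intro τ
      obtain ⟨j, -, hj⟩ := hζ.eq_pow_of_pow_eq_one (ξ := τ w / w)
        (by rw [div_pow, ← map_pow, hw, AlgEquiv.commutes,
          div_self (by simpa using hu)])
      have hτw : τ w = ζ ^ j * w := by rw [hj]; field_simp
      have hcomm : τ (σ w) = σ (τ w) := by
        rw [← AlgEquiv.mul_apply, ← AlgEquiv.mul_apply, mul_comm' τ σ]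
      rw [map_div₀, hcomm, map_pow, hτw, map_mul, map_pow, hs]
      have := pow_ne_zero j hζ0
      field_simp
      ring
    obtain ⟨c, hc⟩ := IntermediateField.mem_bot.1 ((IsGalois.mem_bot_iff_fixed _).2 hfix)
    refine ⟨c, (algebraMap L L').injective ?_⟩
    rw [map_pow, hc, div_pow, ← map_pow, hw, pow_right_comm, hw, zpow_sub₀ hu]
    simp
  obtain ⟨g, hg⟩ := Int.subgroup_cyclic D
  rw [← AddSubgroup.zmultiples_eq_closure] at hg
  have hmem : ∀ d : ℤ, d ∈ D ↔ g ∣ d := fun d ↦ by rw [hg, Int.mem_zmultiples_iff]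
  obtain ⟨M, hM⟩ := (hmem _).1 hND
  have hM0 : M ≠ 0 := by
    rintro rfl
    simp [hN.ne'] at hM
  have hfix : ∀ τ : Gal(L'/L), τ (ζ ^ M) = ζ ^ M := by
    intro τ
    obtain ⟨t, ht⟩ := (hmem _).1 (hsD τ)
    rw [map_zpow₀, hs, ← zpow_natCast, ← zpow_mul, ← div_eq_one_iff_eq (zpow_ne_zero _ hζ0),
      ← zpow_sub₀ hζ0, hζ.zpow_eq_one_iff_dvd]
    exact ⟨-t, by rw [hM]; linear_combination -M * ht⟩
  obtain ⟨ξ, hξ⟩ := IntermediateField.mem_bot.1 ((IsGalois.mem_bot_iff_fixed _).2 hfix)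
  have hξW : ξ ^ W = 1 := hW ξ (isOfFinOrder_iff_pow_eq_one.2 ⟨N, hN, (algebraMap L L').injective
    (by rw [map_pow, hξ, map_one, ← zpow_natCast, ← zpow_mul, hζ.zpow_eq_one_iff_dvd]
        exact dvd_mul_left _ _)⟩)
  have hgW : g ∣ W := by
    have := congrArg (algebraMap L L') hξW
    rw [map_pow, hξ, map_one, ← zpow_natCast, ← zpow_mul, hζ.zpow_eq_one_iff_dvd, hM,
      mul_comm g] at this
    exact (mul_dvd_mul_iff_left hM0).1 this
  obtain ⟨c, hc⟩ := (hmem W).2 hgW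
  exact ⟨c, by simpa using hc⟩

theorem exists_units_pow_eq_of_forall_modulus {L : Type*} [Field L] [NumberField L] {N : ℕ}
    (hN : 0 < N) (u : (𝓞 L)ˣ)
    (h : ∀ n : ℕ, 0 < n → ∃ a : 𝓞 L, (n : 𝓞 L) ∣ a ^ N - u) :
    ∃ c : (𝓞 L)ˣ, c ^ N = u ^ NumberField.Units.torsionOrder L := by
  have : NeZero N := ⟨hN.ne'⟩
  let L' := CyclotomicField N L
  have hζ := IsCyclotomicExtension.zeta_spec N L L'
  have hζ' := hζ.toInteger_isPrimitiveRoot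
  obtain ⟨w, hw⟩ := exists_pow_eq_of_forall_prime hN hζ' (algebraMap (𝓞 L) (𝓞 L') u)
    (u.isUnit.map _) (by
      intro p hp _
      have hp0 : p ≠ ⊥ := hp.ne_zero
      obtain ⟨a, b, hab⟩ := h (Ideal.absNorm p)
        (Nat.pos_of_ne_zero fun h ↦ hp0 (Ideal.absNorm_eq_zero_iff.1 h))
      refine ⟨algebraMap (𝓞 L) (𝓞 L') a, ?_⟩
      rw [← map_pow, ← map_sub, hab, map_mul, map_natCast]
      exact p.mul_mem_right _ (Ideal.absNorm_mem p))
  have hW : ∀ ξ : L, IsOfFinOrder ξ → ξ ^ NumberField.Units.torsionOrder L = 1 := by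
    intro ξ hξ
    obtain ⟨n, hn, hn1⟩ := isOfFinOrder_iff_pow_eq_one.1 hξ
    let x : 𝓞 L := ⟨ξ, IsIntegral.of_pow hn (by rw [hn1]; exact isIntegral_one)⟩
    have hx : x ^ n = 1 := RingOfIntegers.ext hn1
    let y : (𝓞 L)ˣ := Units.ofPowEqOne x n hx hn.ne'
    have hy : y ∈ NumberField.Units.torsion L := by
      rw [NumberField.Units.torsion, CommGroup.mem_torsion]
      exact isOfFinOrder_iff_pow_eq_one.2 ⟨n, hn, Units.ext (by simp [y])⟩
    have : (⟨y, hy⟩ : NumberField.Units.torsion L) ^ NumberField.Units.torsionOrder L = 1 := pow_card_eq_one'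
    have := congrArg (fun z : NumberField.Units.torsion L ↦ ((z : (𝓞 L)ˣ) : L)) this
    have hyx : (y : 𝓞 L) = x := Units.val_ofPowEqOne _ _ hx hn.ne'
    simp only [NumberField.Units.coe_pow, Subgroup.coe_pow, hyx] at this
    simpa using! this
  obtain ⟨c, hc⟩ := exists_zpow_eq_pow_of_cyclotomic (L := L) (L' := L') (N := N) hW
    (u := (u : L)) (by simp) hw
  have hcint : IsIntegral ℤ c := IsIntegral.of_pow hN (by
    rw [hc]; exact (RingOfIntegers.isIntegral_coe _).pow _)
  obtain ⟨c, rfl⟩ : ∃ c' : 𝓞 L, (c' : L) = c := ⟨⟨c, hcint⟩, rfl⟩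
  have hc' : c ^ N = ((u ^ NumberField.Units.torsionOrder L : (𝓞 L)ˣ) : 𝓞 L) :=
    RingOfIntegers.ext (by simpa using hc)
  obtain ⟨v, hv⟩ := (isUnit_pow_iff hN.ne').1 (hc' ▸ Units.isUnit _ : IsUnit (c ^ N))
  exact ⟨v, Units.ext (by rw [← hc', ← hv, Units.val_pow_eq_pow_val])⟩

theorem exists_modulus_forall_units_pow (L : Type*) [Field L] [NumberField L] {e : ℕ}
    (he : 0 < e) : ∃ n : ℕ, 0 < n ∧ ∀ u : (𝓞 L)ˣ, (n : 𝓞 L) ∣ u - 1 → ∃ v : (𝓞 L)ˣ, v ^ e = u := by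
  classical
  set W := NumberField.Units.torsionOrder L with hWdef
  have hW : 0 < W := NumberField.Units.torsionOrder_pos L
  have h6 : Ideal.span {(6 : 𝓞 L)} ≠ ⊥ := by simp
  have : Finite (𝓞 L ⧸ Ideal.span {(6 : 𝓞 L)}) := Ideal.finiteQuotientOfFreeOfNeBot _ h6
  set W' := Nat.card (𝓞 L ⧸ Ideal.span {(6 : 𝓞 L)})ˣ with hW'def
  have hW' : 0 < W' := Nat.card_pos
  have hmod : ∀ v : (𝓞 L)ˣ, (6 : 𝓞 L) ∣ ((v ^ W' : (𝓞 L)ˣ) : 𝓞 L) - 1 := by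
    intro v
    have h1 : (Units.map (Ideal.Quotient.mk (Ideal.span {(6 : 𝓞 L)})).toMonoidHom v) ^ W' = 1 :=
      pow_card_eq_one'
    have h2 := congrArg Units.val h1
    rw [← Ideal.mem_span_singleton, ← Ideal.Quotient.eq_zero_iff_mem, map_sub, sub_eq_zero]
    simpa using h2
  set N := W * (W' * e) with hNdef
  have hN : 0 < N := by positivity
  -- units congruent to one modulo `6` that are everywhere locally `N`-th powers
  have key : ∀ u : (𝓞 L)ˣ, (6 : 𝓞 L) ∣ u - 1 →
      (∀ n : ℕ, 0 < n → ∃ a : 𝓞 L, (n : 𝓞 L) ∣ a ^ N - u) → ∃ v : (𝓞 L)ˣ, v ^ e = u := by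
    intro u hu h
    obtain ⟨c, hc⟩ := exists_units_pow_eq_of_forall_modulus hN u h
    set b := (c ^ e) ^ W' with hb
    have hb1 : (6 : 𝓞 L) ∣ b - 1 := hmod _
    have hub : (u * b⁻¹) ^ W = 1 := by
      rw [mul_pow, ← hc, hNdef, inv_pow, hb]
      rw [← pow_mul, ← pow_mul, mul_inv_eq_one]
      congr 1; ring
    have h6' : (6 : 𝓞 L) ∣ ((u * b⁻¹ : (𝓞 L)ˣ) : 𝓞 L) - 1 := by
      have : ((u * b⁻¹ : (𝓞 L)ˣ) : 𝓞 L) - 1 = ((u - 1) - (b - 1)) * ((b⁻¹ : (𝓞 L)ˣ) : 𝓞 L) := by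
        simp [sub_mul]
      rw [this]
      exact (dvd_sub hu hb1).mul_right _
    obtain ⟨x, hx⟩ := h6'
    have h1 := eq_one_of_sub_one_eq_six_mul (F := L) (ζ := ((u * b⁻¹ : (𝓞 L)ˣ) : L)) (x := x) hW
      (by rw [← NumberField.Units.coe_pow, hub, NumberField.Units.coe_one]) x.isIntegral_coe
      (by have := congrArg (algebraMap (𝓞 L) L) hx; simpa [map_ofNat] using this)
    have h2 : u * b⁻¹ = 1 := Units.ext (RingOfIntegers.ext (by simpa using h1))
    refine ⟨c ^ W', ?_⟩
    rw [mul_inv_eq_one.1 h2, hb, pow_right_comm]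
  -- finitely many classes modulo `N`-th powers
  let P : Subgroup (𝓞 L)ˣ := (powMonoidHom N).range
  have : Group.FG (𝓞 L)ˣ := Group.fg_iff_monoid_fg.2 inferInstance
  have hfin : Finite ((𝓞 L)ˣ ⧸ P) := by
    apply CommGroup.finite_of_fg_isMulTorsion
    intro c
    obtain ⟨v, rfl⟩ := QuotientGroup.mk_surjective c
    exact isOfFinOrder_iff_pow_eq_one.2 ⟨N, hN, (QuotientGroup.eq_one_iff _).2 ⟨v, rfl⟩⟩
  have := Fintype.ofFinite ((𝓞 L)ˣ ⧸ P)
  have hn : ∀ c : (𝓞 L)ˣ ⧸ P, ∃ n : ℕ, 0 < n ∧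
      ((∃ a : 𝓞 L, (n : 𝓞 L) ∣ a ^ N - (Quotient.out c : (𝓞 L)ˣ)) →
        ∀ n : ℕ, 0 < n → ∃ a : 𝓞 L, (n : 𝓞 L) ∣ a ^ N - (Quotient.out c : (𝓞 L)ˣ)) := by
    intro c
    by_contra! hcon
    obtain ⟨-, n, hn, hna⟩ := hcon 1 one_pos
    obtain ⟨⟨a, ha⟩, -⟩ := hcon n hn
    exact hna a ha
  choose n hn hna using hn
  refine ⟨6 * ∏ c, n c, by have := Finset.prod_pos (s := Finset.univ) fun c _ ↦ hn c; positivity, ?_⟩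
  intro u hu
  have hu6 : (6 : 𝓞 L) ∣ u - 1 := (Dvd.intro _ (by push_cast; rfl)).trans hu
  have hun : (n (u : (𝓞 L)ˣ ⧸ P) : 𝓞 L) ∣ u - 1 := by
    refine dvd_trans ?_ hu
    exact_mod_cast (Nat.cast_dvd_cast ((Finset.dvd_prod_of_mem n (Finset.mem_univ _)).trans
      (dvd_mul_left _ 6)) : ((n (u : (𝓞 L)ˣ ⧸ P) : ℕ) : 𝓞 L) ∣ _)
  obtain ⟨y, hy⟩ : ∃ y : (𝓞 L)ˣ, u = Quotient.out (u : (𝓞 L)ˣ ⧸ P) * y ^ N := by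
    have : (Quotient.out (u : (𝓞 L)ˣ ⧸ P))⁻¹ * u ∈ P :=
      QuotientGroup.eq.1 (QuotientGroup.out_eq' _)
    obtain ⟨y, hy⟩ := this
    exact ⟨y, by rw [← powMonoidHom_apply, hy, mul_inv_cancel_left]⟩
  set r := Quotient.out (u : (𝓞 L)ˣ ⧸ P)
  refine key u hu6 fun t ht ↦ ?_
  have hr : (r : 𝓞 L) = u * ((y⁻¹ : (𝓞 L)ˣ) : 𝓞 L) ^ N := by
    rw [← Units.val_pow_eq_pow_val, ← Units.val_mul]; congr 1; rw [hy]; simp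
  obtain ⟨a, ha⟩ := hna (u : (𝓞 L)ˣ ⧸ P) ⟨((y⁻¹ : (𝓞 L)ˣ) : 𝓞 L), by
    change _ ∣ _ - (r : 𝓞 L)
    rw [hr, ← neg_sub, dvd_neg, ← sub_one_mul]
    exact hun.mul_right _⟩ t ht
  refine ⟨a * y, ?_⟩
  have : (a * (y : 𝓞 L)) ^ N - u = (a ^ N - r) * (y : 𝓞 L) ^ N := by
    conv_lhs => rw [hy]
    push_cast; ring
  rw [this]
  exact ha.mul_right _

theorem exists_nsmul_eq_zero_of_isOfFinAddOrder (A : Type*) [AddCommGroup A] [Module.Finite ℤ A] :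
    ∃ e : ℕ, 0 < e ∧ ∀ x : A, IsOfFinAddOrder x → e • x = 0 := by
  have : Finite (Submodule.torsion ℤ A) :=
    Module.finite_of_fg_torsion _ (Submodule.torsion_isTorsion)
  refine ⟨Nat.card (Submodule.torsion ℤ A), Nat.card_pos, fun x hx ↦ ?_⟩
  obtain ⟨n, hn, hn0⟩ := isOfFinAddOrder_iff_nsmul_eq_zero.1 hx
  have hmem : x ∈ Submodule.torsion ℤ A :=
    (Submodule.mem_torsion_iff x).2 ⟨⟨n, by simpa using hn.ne'⟩, by simpa using hn0⟩
  exact congrArg Subtype.val (card_nsmul_eq_zero' (x := (⟨x, hmem⟩ : Submodule.torsion ℤ A)))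

theorem AddSubgroup.exists_forall_nsmul_mem {A : Type*} [AddCommGroup A] [Module.Finite ℤ A]
    (B U : AddSubgroup A) (h : B.relIndex U ≠ 0) :
    ∃ e : ℕ, 0 < e ∧ ∀ x : A, e • x ∈ U → e • x ∈ B := by
  have : Module.Finite ℤ (A ⧸ B) :=
    Module.Finite.of_surjective (QuotientAddGroup.mk' B).toIntLinearMap
      (QuotientAddGroup.mk'_surjective B)
  obtain ⟨e, he, hA⟩ := exists_nsmul_eq_zero_of_isOfFinAddOrder (A ⧸ B)
  refine ⟨e, he, fun x hx ↦ ?_⟩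
  obtain ⟨n, hn, -, hnx⟩ := AddSubgroup.exists_nsmul_mem_of_relIndex_ne_zero h hx
  have := hA x (isOfFinAddOrder_iff_nsmul_eq_zero.2 ⟨n * e, by positivity, by
    rw [← QuotientAddGroup.mk_nsmul, QuotientAddGroup.eq_zero_iff, mul_smul]
    exact hnx.1⟩)
  rwa [← QuotientAddGroup.mk_nsmul, QuotientAddGroup.eq_zero_iff] at this

theorem exists_modulus_forall_units_mem {L ι : Type*} [Field L] [NumberField L] [Finite ι]
    (B U : Subgroup (ι → (𝓞 L)ˣ)) (h : B.relIndex U ≠ 0) :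
    ∃ n : ℕ, 0 < n ∧ ∀ u ∈ U, (∀ i, (n : 𝓞 L) ∣ u i - 1) → u ∈ B := by
  have : Group.FG (𝓞 L)ˣ := Group.fg_iff_monoid_fg.2 inferInstance
  have : Module.Finite ℤ (Additive (𝓞 L)ˣ) := Module.Finite.iff_addGroup_fg.2 inferInstance
  let f : (ι → Additive (𝓞 L)ˣ) ≃+ Additive (ι → (𝓞 L)ˣ) :=
    { toFun := fun x ↦ Additive.ofMul fun i ↦ (x i).toMul
      invFun := fun x i ↦ Additive.ofMul (x.toMul i)
      left_inv := fun _ ↦ rfl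
      right_inv := fun _ ↦ rfl
      map_add' := fun _ _ ↦ rfl }
  have : Module.Finite ℤ (Additive (ι → (𝓞 L)ˣ)) :=
    Module.Finite.equiv f.toIntLinearEquiv
  obtain ⟨e, he, hB⟩ := AddSubgroup.exists_forall_nsmul_mem (Subgroup.toAddSubgroup B)
    (Subgroup.toAddSubgroup U) h
  obtain ⟨n, hn, hv⟩ := exists_modulus_forall_units_pow L he
  refine ⟨n, hn, fun u hu hun ↦ ?_⟩
  choose v hv using fun i ↦ hv (u i) (hun i)
  obtain rfl : v ^ e = u := funext hv
  exact hB (Additive.ofMul v) hu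

/-- A linear representation is neat if no nontrivial root of unity is a quotient of two eigenvalues
of one of its operators. -/
def IsNeat {F V G : Type*} [Field F] [AddCommGroup V] [Module F V] [Group G]
    (ρ : G →* Module.End F V) : Prop :=
  ∀ (g : G) (μ ζ : F) (n : ℕ), 0 < n → ζ ^ n = 1 → (ρ g).HasEigenvalue μ →
    (ρ g).HasEigenvalue (ζ * μ) → ζ = 1

section

variable {F V G : Type*} [Field F] [AddCommGroup V] [Module F V] [Group G]
  {ρ : G →* Module.End F V}

theorem map_inv_apply_map_apply (ρ : G →* Module.End F V) (g : G) (v : V) :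
    ρ g⁻¹ (ρ g v) = v := by
  rw [← Module.End.mul_apply, ← map_mul, inv_mul_cancel, map_one, Module.End.one_apply]

theorem map_apply_ne_zero (ρ : G →* Module.End F V) (g : G) {v : V} (hv : v ≠ 0) : ρ g v ≠ 0 :=
  fun h ↦ hv (by rw [← map_inv_apply_map_apply ρ g v, h, map_zero])

theorem exists_minimal_invariant [FiniteDimensional F V] [Nontrivial V] {ι : Type*}
    (f : ι → Module.End F V) :
    ∃ W : Submodule F V, W ≠ ⊥ ∧ (∀ i, W ≤ W.comap (f i)) ∧
      ∀ W' ≤ W, W' ≠ ⊥ → (∀ i, W' ≤ W'.comap (f i)) → W' = W := by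
  obtain ⟨W, ⟨hW0, hW⟩, hmin⟩ := wellFounded_lt.has_min
    {W : Submodule F V | W ≠ ⊥ ∧ ∀ i, W ≤ W.comap (f i)} ⟨⊤, top_ne_bot, fun i ↦ by simp⟩
  exact ⟨W, hW0, hW, fun W' hle h0 h ↦ hle.eq_of_not_lt (hmin W' ⟨h0, h⟩)⟩

theorem exists_eigenvector_mem [IsAlgClosed F] [FiniteDimensional F V] {W : Submodule F V}
    (hW : W ≠ ⊥) {f : Module.End F V} (hf : W ≤ W.comap f) :
    ∃ v ∈ W, v ≠ 0 ∧ ∃ c : F, f v = c • v := by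
  have : Nontrivial W := Submodule.nontrivial_iff_ne_bot.2 hW
  obtain ⟨c, hc⟩ := Module.End.exists_eigenvalue (f.restrict hf)
  obtain ⟨v, hv⟩ := hc.exists_hasEigenvector
  exact ⟨v, v.2, by simpa using hv.2, c, by simpa using congrArg Subtype.val hv.apply_eq_smul⟩

theorem exists_common_eigenvector_of_commute [IsAlgClosed F] [FiniteDimensional F V] [Nontrivial V]
    {ι : Type*} (f : ι → Module.End F V) (h : ∀ i j, Commute (f i) (f j)) :
    ∃ v : V, v ≠ 0 ∧ ∃ χ : ι → F, ∀ i, f i v = χ i • v := by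
  obtain ⟨W, hW0, hW, hmin⟩ := exists_minimal_invariant f
  have hsc : ∀ i, ∃ c : F, ∀ v ∈ W, f i v = c • v := by
    intro i
    obtain ⟨v, hvW, hv0, c, hc⟩ := exists_eigenvector_mem hW0 (hW i)
    have := hmin (W ⊓ (f i).eigenspace c) inf_le_left
      (Submodule.ne_bot_iff _ |>.2 ⟨v, ⟨hvW, Module.End.mem_eigenspace_iff.2 hc⟩, hv0⟩) (by
        rintro j x ⟨hxW, hx⟩
        refine ⟨hW j hxW, ?_⟩
        rw [SetLike.mem_coe, Module.End.mem_eigenspace_iff] at hx ⊢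
        rw [← Module.End.mul_apply, (h i j).eq, Module.End.mul_apply, hx, map_smul])
    exact ⟨c, fun v hv ↦ Module.End.mem_eigenspace_iff.1 (inf_eq_left.1 this hv)⟩
  choose χ hχ using hsc
  obtain ⟨v, hv, hv0⟩ := (Submodule.ne_bot_iff _).1 hW0
  exact ⟨v, hv0, χ, fun i ↦ hχ i v hv⟩

theorem hasEigenvalue_of_apply_eq_smul {f : Module.End F V} {v : V} {c : F} (hv : v ≠ 0)
    (h : f v = c • v) : f.HasEigenvalue c :=
  Module.End.hasEigenvalue_of_hasEigenvector ⟨Module.End.mem_eigenspace_iff.2 h, hv⟩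

/-- In a neat representation, two operators whose commutator is a scalar commute. -/
theorem IsNeat.eq_one_of_mul_eq_smul [IsAlgClosed F] [FiniteDimensional F V] [Nontrivial V]
    (hρ : IsNeat ρ) {x b : G} {ζ : F} (h : ρ b * ρ x = ζ • (ρ x * ρ b)) : ζ = 1 := by
  obtain ⟨c, hc⟩ := Module.End.exists_eigenvalue (ρ b)
  obtain ⟨v, hv⟩ := hc.exists_hasEigenvector
  have hv0 := hv.2
  have hb := hv.apply_eq_smul
  have hc0 : c ≠ 0 := by
    rintro rfl
    exact map_apply_ne_zero ρ b hv0 (by rw [hb, zero_smul])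
  have hxv : ∀ i : ℕ, (ρ b) ((ρ x ^ i) v) = (ζ ^ i * c) • (ρ x ^ i) v := by
    intro i
    induction i with
    | zero => simpa using hb
    | succ i ih =>
      rw [pow_succ', Module.End.mul_apply, ← Module.End.mul_apply (ρ b), h, LinearMap.smul_apply,
        Module.End.mul_apply, ih, map_smul, smul_smul, pow_succ', mul_assoc]
  have hne : ∀ i : ℕ, (ρ x ^ i) v ≠ 0 := fun i ↦ by
    rw [← map_pow]; exact map_apply_ne_zero ρ _ hv0
  have hev : ∀ i : ℕ, (ρ b).HasEigenvalue (ζ ^ i * c) := fun i ↦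
    hasEigenvalue_of_apply_eq_smul (hne i) (hxv i)
  have hζ0 : ζ ≠ 0 := by
    rintro rfl
    have := hxv 1
    rw [pow_one, pow_one, zero_mul, zero_smul] at this
    exact map_apply_ne_zero ρ b (by simpa using hne 1) this
  have hninj : ¬ Function.Injective fun i : ℕ ↦ ζ ^ i * c := fun hinj ↦
    Set.infinite_of_injective_forall_mem hinj hev (Module.End.finite_hasEigenvalue _)
  obtain ⟨i, j, hij, hne'⟩ := Function.not_injective_iff.1 hninj
  obtain ⟨n, hn, hn1⟩ : ∃ n : ℕ, 0 < n ∧ ζ ^ n = 1 := by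
    have hij' : ζ ^ i = ζ ^ j := mul_right_cancel₀ hc0 hij
    rcases lt_or_gt_of_ne hne' with hlt | hlt
    · exact ⟨j - i, by omega, by rw [pow_sub₀ _ hζ0 hlt.le, hij', mul_inv_cancel₀ (pow_ne_zero _ hζ0)]⟩
    · exact ⟨i - j, by omega, by rw [pow_sub₀ _ hζ0 hlt.le, hij', mul_inv_cancel₀ (pow_ne_zero _ hζ0)]⟩
  exact hρ b c ζ n hn hn1 hc (by simpa using hev 1)

theorem IsNeat.exists_scalar_of_commute [IsAlgClosed F] [CharZero F] [FiniteDimensional F V]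
    [Nontrivial V] (hρ : IsNeat ρ)
    (hirr : ∀ W : Submodule F V, W ≠ ⊥ → (∀ g, W ≤ W.comap (ρ g)) → W = ⊤)
    (A : Subgroup G) [hA : A.Normal] (hcomm : ∀ a b : A, Commute (ρ a) (ρ b)) (a : A) :
    ∃ c : F, ρ a = c • 1 := by
  obtain ⟨v, hv0, χ, hχ⟩ := exists_common_eigenvector_of_commute (fun a : A ↦ ρ a) hcomm
  let E : (A → F) → Submodule F V := fun χ ↦ ⨅ a : A, (ρ a).eigenspace (χ a)
  have hE : ∀ χ v, v ∈ E χ ↔ ∀ a : A, ρ a v = χ a • v := fun χ v ↦ by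
    simp [E]
  have hindep : iSupIndep E :=
    (Module.End.independent_iInf_maxGenEigenspace_of_forall_mapsTo (fun a : A ↦ ρ a)
      fun i j φ ↦ Module.End.mapsTo_maxGenEigenspace_of_comm (hcomm j i) φ).mono
      fun χ ↦ iInf_mono fun a ↦ (Module.End.genEigenspace _ _).mono le_top
  have hfin : {χ | E χ ≠ ⊥}.Finite := WellFoundedGT.finite_ne_bot_of_iSupIndep hindep
  have hEχ : E χ ≠ ⊥ := (Submodule.ne_bot_iff _).2 ⟨v, (hE _ _).2 hχ, hv0⟩
  -- the weight space is invariant under the whole group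
  have hinv : ∀ g, E χ ≤ (E χ).comap (ρ g) := by
    intro g
    let T : (A → F) → (A → F) := fun χ a ↦ χ ⟨g⁻¹ * a * g, by
      simpa using hA.conj_mem a a.2 g⁻¹⟩
    have hTinj : Function.Injective T := by
      intro χ₁ χ₂ h
      funext a
      have := congrFun h ⟨g * a * g⁻¹, hA.conj_mem a a.2 g⟩
      simpa [T, mul_assoc] using this
    have hT : ∀ χ v, v ∈ E χ → ρ g v ∈ E (T χ) := by
      intro χ v hv
      rw [hE] at hv ⊢
      intro a
      have := hv ⟨g⁻¹ * a * g, by simpa using hA.conj_mem a a.2 g⁻¹⟩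
      have h2 := congrArg (ρ g) this
      simp only [map_smul] at h2
      rw [← h2, ← Module.End.mul_apply, ← Module.End.mul_apply, ← map_mul, ← map_mul]
      simp [mul_assoc]
    have hTi : ∀ i χ v, v ∈ E χ → ρ (g ^ i) v ∈ E (T^[i] χ) := by
      intro i
      induction i with
      | zero => intro χ v hv; simpa using hv
      | succ i ih =>
        intro χ v hv
        rw [Function.iterate_succ_apply', pow_succ', map_mul]
        exact hT _ _ (ih _ _ hv)
    have hper : χ ∈ Function.periodicPts T := by
      have hninj : ¬ Function.Injective fun i : ℕ ↦ T^[i] χ := fun hinj ↦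
        Set.infinite_of_injective_forall_mem hinj (fun i ↦ (Submodule.ne_bot_iff _).2
          ⟨_, hTi i χ v ((hE _ _).2 hχ), map_apply_ne_zero ρ _ hv0⟩) hfin
      obtain ⟨i, j, hij, hne⟩ := Function.not_injective_iff.1 hninj
      have aux : ∀ i j : ℕ, i < j → T^[i] χ = T^[j] χ → χ ∈ Function.periodicPts T := by
        intro i j hlt hij
        refine ⟨j - i, by omega, hTinj.iterate i ?_⟩
        rw [← Function.iterate_add_apply, Nat.add_sub_cancel' hlt.le, hij]
      rcases lt_or_gt_of_ne hne with hlt | hlt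
      · exact aux i j hlt hij
      · exact aux j i hlt hij.symm
    set r := Function.minimalPeriod T χ with hr
    have hr0 : 0 < r := Function.minimalPeriod_pos_of_mem_periodicPts hper
    have hTr : T^[r] χ = χ := Function.iterate_minimalPeriod
    obtain ⟨w, hwE, hw0, c, hc⟩ := exists_eigenvector_mem (f := ρ (g ^ r)) hEχ
      (fun v hv ↦ by simpa only [hTr, Submodule.mem_comap] using hTi r χ v hv)
    have hc0 : c ≠ 0 := by
      rintro rfl
      exact map_apply_ne_zero ρ _ hw0 (by rw [hc, zero_smul])
    have hli : LinearIndependent F fun i : Fin r ↦ ρ (g ^ (i : ℕ)) w := by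
      refine (hindep.comp (f := fun i : Fin r ↦ T^[i] χ) ?_).linearIndependent _
        (fun i ↦ hTi i χ w hwE) (fun i ↦ map_apply_ne_zero ρ _ hw0)
      intro i j hij
      exact Fin.ext (Function.iterate_injOn_Iio_minimalPeriod i.2 j.2 hij)
    have hev : ∀ l : F, l ^ r = c → (ρ g).HasEigenvalue l := by
      intro l hl
      have hl0 : l ≠ 0 := by
        rintro rfl
        exact hc0 (by rw [← hl, zero_pow hr0.ne'])
      refine hasEigenvalue_of_apply_eq_smul
        (v := ∑ i ∈ Finset.range r, (l ^ i)⁻¹ • ρ (g ^ i) w) ?_ ?_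
      · intro h0
        rw [← Fin.sum_univ_eq_sum_range (fun i ↦ (l ^ i)⁻¹ • ρ (g ^ i) w) r] at h0
        have := Fintype.linearIndependent_iff.1 hli (fun i ↦ (l ^ (i : ℕ))⁻¹) h0 ⟨0, hr0⟩
        simp at this
      · have hstep : ∀ i : ℕ, ρ g ((l ^ i)⁻¹ • ρ (g ^ i) w) =
            l • ((l ^ (i + 1))⁻¹ • ρ (g ^ (i + 1)) w) := by
          intro i
          rw [map_smul, ← Module.End.mul_apply, ← map_mul, ← pow_succ', smul_smul]
          congr 1
          field_simp
          rw [pow_succ]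
        rw [map_sum, Finset.sum_congr rfl fun i _ ↦ hstep i, ← Finset.smul_sum]
        congr 1
        have e1 := Finset.sum_range_succ (fun i ↦ (l ^ i)⁻¹ • ρ (g ^ i) w) r
        have e2 := Finset.sum_range_succ' (fun i ↦ (l ^ i)⁻¹ • ρ (g ^ i) w) r
        rw [e1] at e2
        have e3 : (l ^ r)⁻¹ • ρ (g ^ r) w = w := by rw [hc, hl, smul_smul, inv_mul_cancel₀ hc0, one_smul]
        rw [e3] at e2
        simp only [pow_zero, inv_one, one_smul, map_one, Module.End.one_apply] at e2
        exact (add_right_cancel e2).symm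
    obtain ⟨l, hl⟩ := IsAlgClosed.exists_pow_nat_eq c hr0
    have : NeZero (r : F) := ⟨by exact_mod_cast hr0.ne'⟩
    obtain ⟨ζ, hζ⟩ := HasEnoughRootsOfUnity.exists_primitiveRoot F r
    have hζ1 := hρ g l ζ r hr0 hζ.pow_eq_one (hev l hl) (hev _ (by
      rw [mul_pow, hζ.pow_eq_one, one_mul, hl]))
    have hr1 : r = 1 := by rw [hζ1] at hζ; simpa using hζ.eq_orderOf
    intro x hx
    have := hTi 1 χ x hx
    rw [hr1] at hTr
    rwa [hTr, pow_one] at this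
  have htop := hirr _ hEχ hinv
  refine ⟨χ a, LinearMap.ext fun x ↦ ?_⟩
  simpa using (hE χ x).1 (htop ▸ Submodule.mem_top) a

open scoped commutatorElement in
theorem IsNeat.exists_scalar_of_irreducible [IsAlgClosed F] [CharZero F] [FiniteDimensional F V]
    [Nontrivial V] [Group.IsSolvable G] (hρ : IsNeat ρ)
    (hirr : ∀ W : Submodule F V, W ≠ ⊥ → (∀ g, W ≤ W.comap (ρ g)) → W = ⊤) (g : G) :
    ∃ c : F, ρ g = c • 1 := by
  obtain ⟨n, hn⟩ := Group.IsSolvable.solvable (G := G)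
  have key : ∀ i ≤ n, ∀ a ∈ derivedSeries G (n - i), ∃ c : F, ρ a = c • 1 := by
    intro i
    induction i with
    | zero =>
      intro _ a ha
      rw [Nat.sub_zero, hn, Subgroup.mem_bot] at ha
      exact ⟨1, by rw [ha, map_one, one_smul]⟩
    | succ i ih =>
      intro hi a ha
      have hsucc : n - i = (n - (i + 1)) + 1 := by omega
      have ih := ih (by omega)
      rw [hsucc, derivedSeries_succ] at ih
      refine hρ.exists_scalar_of_commute hirr (derivedSeries G (n - (i + 1))) ?_ ⟨a, ha⟩
      intro b x
      obtain ⟨c, hc⟩ := ih _ (Subgroup.commutator_mem_commutator b.2 x.2)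
      have h : ρ b * ρ x = c • (ρ x * ρ b) := by
        have hbx : (b * x : G) = ⁅(b : G), (x : G)⁆ * (x * b) := by
          rw [commutatorElement_def]; group
        rw [← map_mul, hbx, map_mul, hc, smul_mul_assoc, one_mul, map_mul]
      have hc1 := hρ.eq_one_of_mul_eq_smul h
      rw [hc1, one_smul] at h
      exact h
  exact key n le_rfl g (by simp)

theorem IsNeat.exists_common_eigenvector [IsAlgClosed F] [CharZero F] [FiniteDimensional F V]
    [Nontrivial V] [Group.IsSolvable G] (hρ : IsNeat ρ) :
    ∃ v : V, v ≠ 0 ∧ ∀ g, ∃ c : F, ρ g v = c • v := by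
  obtain ⟨W, hW0, hW, hmin⟩ := exists_minimal_invariant fun g ↦ ρ g
  let ρ' : G →* Module.End F W :=
    { toFun := fun g ↦ (ρ g).restrict (hW g)
      map_one' := by ext; simp
      map_mul' := fun g h ↦ by ext; simp }
  have hρ'v : ∀ g (v : W), ((ρ' g v : W) : V) = ρ g v := fun g v ↦ rfl
  have : Nontrivial W := Submodule.nontrivial_iff_ne_bot.2 hW0
  have hev : ∀ g c, (ρ' g).HasEigenvalue c → (ρ g).HasEigenvalue c := by
    intro g c hc
    obtain ⟨v, hv⟩ := hc.exists_hasEigenvector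
    exact hasEigenvalue_of_apply_eq_smul (v := (v : V)) (by simpa using hv.2)
      (by simpa [hρ'v] using congrArg Subtype.val hv.apply_eq_smul)
  have hρ' : IsNeat ρ' := fun g μ ζ n hn hζ h₁ h₂ ↦ hρ g μ ζ n hn hζ (hev _ _ h₁) (hev _ _ h₂)
  have hirr : ∀ U : Submodule F W, U ≠ ⊥ → (∀ g, U ≤ U.comap (ρ' g)) → U = ⊤ := by
    intro U hU0 hU
    have := hmin (U.map W.subtype) (Submodule.map_subtype_le _ _)
      (fun h ↦ hU0 (Submodule.map_injective_of_injective W.injective_subtype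
        (by rw [h, Submodule.map_bot]))) (by
        rintro g _ ⟨x, hx, rfl⟩
        exact ⟨ρ' g x, hU g hx, hρ'v g x⟩)
    apply Submodule.map_injective_of_injective W.injective_subtype
    rw [this, Submodule.map_top, Submodule.range_subtype]
  obtain ⟨v, hv⟩ := exists_ne (0 : W)
  refine ⟨v, by simpa using hv, fun g ↦ ?_⟩
  obtain ⟨c, hc⟩ := hρ'.exists_scalar_of_irreducible hirr g
  exact ⟨c, by rw [← hρ'v, hc]; simp⟩

theorem Module.End.HasEigenvalue.of_mapQ [FiniteDimensional F V] {f : V →ₗ[F] V}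
    {W : Submodule F V} (hf : W ≤ W.comap f) {c : F}
    (hc : Module.End.HasEigenvalue (W.mapQ W f hf) c) : Module.End.HasEigenvalue f c := by
  by_contra hne
  have hker : LinearMap.ker (f - c • (1 : Module.End F V)) = ⊥ := by
    rw [← Module.End.eigenspace_def]
    by_contra h
    exact hne (Module.End.hasEigenvalue_iff.2 h)
  have hsurj : Function.Surjective (f - c • (1 : Module.End F V)) :=
    LinearMap.injective_iff_surjective.1 (LinearMap.ker_eq_bot.1 hker)
  have hsurj' : Function.Surjective (W.mapQ W f hf - c • (1 : Module.End F (V ⧸ W))) := by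
    intro y
    obtain ⟨y, rfl⟩ := W.mkQ_surjective y
    obtain ⟨x, rfl⟩ := hsurj y
    exact ⟨W.mkQ x, by simp⟩
  have hinj := LinearMap.injective_iff_surjective.2 hsurj'
  apply Module.End.hasEigenvalue_iff.1 hc
  rw [Module.End.eigenspace_def]
  exact LinearMap.ker_eq_bot.2 hinj

theorem IsNeat.exists_eigenvector_mod [IsAlgClosed F] [CharZero F] [FiniteDimensional F V]
    [Group.IsSolvable G] (hρ : IsNeat ρ) {W : Submodule F V} (hWtop : W ≠ ⊤)
    (hW : ∀ g, W ≤ W.comap (ρ g)) :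
    ∃ v ∉ W, ∀ g, ∃ c : F, ρ g v - c • v ∈ W := by
  let ρ' : G →* Module.End F (V ⧸ W) :=
    { toFun := fun g ↦ W.mapQ W (ρ g) (hW g)
      map_one' := by ext; simp
      map_mul' := fun g h ↦ by ext; simp }
  have : Nontrivial (V ⧸ W) := Submodule.Quotient.nontrivial_iff.2 hWtop
  have hρ' : IsNeat ρ' := fun g μ ζ n hn hζ h₁ h₂ ↦ hρ g μ ζ n hn hζ
    (h₁.of_mapQ (hf := hW g)) (h₂.of_mapQ (hf := hW g))
  obtain ⟨v, hv0, hv⟩ := hρ'.exists_common_eigenvector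
  obtain ⟨v, rfl⟩ := W.mkQ_surjective v
  refine ⟨v, by simpa using hv0, fun g ↦ ?_⟩
  obtain ⟨c, hc⟩ := hv g
  refine ⟨c, ?_⟩
  rw [← Submodule.Quotient.eq]
  exact hc

theorem IsNeat.exists_triangular [IsAlgClosed F] [CharZero F] [FiniteDimensional F V]
    [Group.IsSolvable G] (hρ : IsNeat ρ) (n : ℕ) (hn : n ≤ Module.finrank F V) :
    ∃ w : Fin n → V, LinearIndependent F w ∧
      ∀ g j, ρ g (w j) ∈ Submodule.span F (w '' Set.Iic j) := by
  induction n with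
  | zero => exact ⟨Fin.elim0, linearIndependent_empty_type, fun g j ↦ j.elim0⟩
  | succ n ih =>
    obtain ⟨w, hw, hinv⟩ := ih (by omega)
    have hWtop : Submodule.span F (Set.range w) ≠ ⊤ := by
      intro h
      have := finrank_span_eq_card hw
      rw [h, finrank_top, Fintype.card_fin] at this
      omega
    obtain ⟨v, hv, hgv⟩ := hρ.exists_eigenvector_mod hWtop (fun g ↦ by
      rw [Submodule.span_le]
      rintro _ ⟨j, rfl⟩
      exact Submodule.span_mono (Set.image_subset_range _ _) (hinv g j))
    refine ⟨Fin.snoc w v, linearIndependent_finSnoc.2 ⟨hw, hv⟩, fun g j ↦ ?_⟩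
    refine Fin.lastCases ?_ (fun j ↦ ?_) j
    · obtain ⟨c, hc⟩ := hgv g
      rw [Fin.snoc_last, ← sub_add_cancel (ρ g v) (c • v)]
      refine add_mem (Submodule.span_mono ?_ hc) (Submodule.smul_mem _ _ (Submodule.subset_span
        ⟨Fin.last n, Set.mem_Iic.2 le_rfl, Fin.snoc_last _ _⟩))
      rintro _ ⟨i, rfl⟩
      exact ⟨i.castSucc, Set.mem_Iic.2 (Fin.le_last _), Fin.snoc_castSucc _ _ _⟩
    · rw [Fin.snoc_castSucc]
      refine Submodule.span_mono ?_ (hinv g j)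
      rintro _ ⟨i, hi, rfl⟩
      exact ⟨i.castSucc, by simpa using hi, Fin.snoc_castSucc _ _ _⟩

end

/-- Every finite-index subgroup of `N` contains the trace on `N` of a member of the family `K`
of subgroups indexed by positive moduli. -/
def HasCongruenceProperty {Γ : Type*} [Group Γ] (K : ℕ → Subgroup Γ) (N : Subgroup Γ) : Prop :=
  ∀ Λ : Subgroup Γ, Λ.relIndex N ≠ 0 → ∃ n : ℕ, 0 < n ∧ K n ⊓ N ≤ Λ

theorem HasCongruenceProperty.of_ker {Γ : Type*} [Group Γ] {K : ℕ → Subgroup Γ}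
    (hK : ∀ a b, K (a * b) ≤ K a ⊓ K b) (hfin : ∀ n, 0 < n → (K n).FiniteIndex)
    {N N' : Subgroup Γ} (hN' : N' ≤ N) (h : HasCongruenceProperty K N') {C : Type*} [Group C]
    (φ : N →* C) (hφ : ∀ g : N, φ g = 1 → (g : Γ) ∈ N')
    (hC : ∀ B : Subgroup C, B.relIndex φ.range ≠ 0 →
      ∃ n : ℕ, 0 < n ∧ ∀ g : N, (g : Γ) ∈ K n → φ g ∈ B) :
    HasCongruenceProperty K N := by
  intro Λ hΛ
  obtain ⟨a, ha, haΛ⟩ := h Λ (mt (Subgroup.relIndex_eq_zero_of_le_right hN') hΛ)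
  let P : Subgroup N := (K a ⊓ Λ).subgroupOf N
  have hP : P.index ≠ 0 := Subgroup.relIndex_inf_ne_zero
    (by
      have := hfin a ha
      exact Subgroup.FiniteIndex.index_ne_zero (H := (K a).subgroupOf N)) hΛ
  obtain ⟨b, hb, hbB⟩ := hC (P.map φ) (by
    rw [MonoidHom.range_eq_map, Subgroup.relIndex_map_map, top_sup_eq, Subgroup.relIndex_top_right]
    exact mt (fun h ↦ Nat.eq_zero_of_zero_dvd (h ▸ Subgroup.index_dvd_of_le le_sup_left)) hP)
  refine ⟨a * b, by positivity, fun g hg ↦ ?_⟩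
  obtain ⟨hgK, hgN⟩ := hg
  obtain ⟨l, hl, hlg⟩ := hbB ⟨g, hgN⟩ (hK a b hgK).2
  have hl' : (l : Γ) ∈ K a ⊓ Λ := hl
  have h1 : g * (l : Γ)⁻¹ ∈ Λ := haΛ ⟨(K a).mul_mem (hK a b hgK).1 ((K a).inv_mem hl'.1),
    hφ (⟨g, hgN⟩ * l⁻¹) (by rw [map_mul, map_inv, hlg, mul_inv_cancel])⟩
  simpa using Λ.mul_mem h1 hl'.2

theorem mul_apply_eq_zero_of_band {R : Type*} [CommRing R] {m a b : ℕ}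
    {X Y : Matrix (Fin m) (Fin m) R} (hX : ∀ i j : Fin m, (j : ℕ) < i + a → X i j = 0)
    (hY : ∀ i j : Fin m, (j : ℕ) < i + b → Y i j = 0) {i j : Fin m} (hij : (j : ℕ) < i + (a + b)) :
    (X * Y) i j = 0 := by
  rw [Matrix.mul_apply]
  refine Finset.sum_eq_zero fun l _ ↦ ?_
  rcases lt_or_ge (l : ℕ) (i + a) with h | h
  · rw [hX i l h, zero_mul]
  · rw [hY l j (by omega), mul_zero]

section

variable {Γ R : Type*} [Group Γ] [CommRing R] {m : ℕ}

theorem map_mul_sub_one (ρ : Γ →* Matrix (Fin m) (Fin m) R) (g h : Γ) :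
    ρ (g * h) - 1 = (ρ g - 1) + (ρ h - 1) + (ρ g - 1) * (ρ h - 1) := by
  rw [map_mul]; noncomm_ring

/-- The elements of an upper triangular matrix group that agree with the identity on the first
`d` diagonals, counted from the main one. -/
def unipotentFiltration (ρ : Γ →* Matrix (Fin m) (Fin m) R)
    (hρ : ∀ g (i j : Fin m), j < i → ρ g i j = 0) (d : ℕ) : Subgroup Γ where
  carrier := {g | ∀ i j : Fin m, (j : ℕ) < i + d → (ρ g - 1) i j = 0}
  one_mem' := by simp
  mul_mem' := by
    intro g h hg hh i j hij
    rw [map_mul_sub_one, Matrix.add_apply, Matrix.add_apply, hg i j hij, hh i j hij,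
      mul_apply_eq_zero_of_band hg hh (by omega)]
    simp
  inv_mem' := by
    intro g hg i j hij
    have h := congrFun (congrFun (map_mul_sub_one ρ g g⁻¹) i) j
    rw [mul_inv_cancel, map_one, sub_self, Matrix.add_apply, Matrix.add_apply, hg i j hij,
      mul_apply_eq_zero_of_band (b := 0) hg (by
        intro i j hij
        rw [Matrix.sub_apply, hρ _ i j (Fin.lt_def.2 hij), Matrix.one_apply_ne
          (Fin.ne_of_gt hij), sub_zero]) hij] at h
    simpa using h.symm

theorem mem_unipotentFiltration {ρ : Γ →* Matrix (Fin m) (Fin m) R}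
    {hρ : ∀ g (i j : Fin m), j < i → ρ g i j = 0} {d : ℕ} {g : Γ} :
    g ∈ unipotentFiltration ρ hρ d ↔ ∀ i j : Fin m, (j : ℕ) < i + d → (ρ g - 1) i j = 0 :=
  Iff.rfl

end

theorem hasCongruenceProperty_of_triangular {Γ L : Type*} [Group Γ] [Field L] [NumberField L]
    {K : ℕ → Subgroup Γ} (hK1 : K 1 = ⊤)
    (hK : ∀ a b, K (a * b) ≤ K a ⊓ K b) (hfin : ∀ n, 0 < n → (K n).FiniteIndex) {m : ℕ}
    (ρ : Γ →* Matrix (Fin m) (Fin m) L) (hinj : Function.Injective ρ)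
    (hρ : ∀ g (i j : Fin m), j < i → ρ g i j = 0)
    (hunit : ∀ g i, ∃ u : (𝓞 L)ˣ, algebraMap (𝓞 L) L u = ρ g i i) {D : ℕ} (hD : 0 < D)
    (hcong : ∀ n, 0 < n → ∀ g ∈ K n, ∀ i j, ∃ y : 𝓞 L, (D : L) * (ρ g - 1) i j = n * algebraMap (𝓞 L) L y) :
    HasCongruenceProperty K ⊤ := by
  have hD0 : (D : L) ≠ 0 := by exact_mod_cast hD.ne'
  have hdiag : ∀ g h i, ρ (g * h) i i = ρ g i i * ρ h i i := by
    intro g h i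
    rw [map_mul, Matrix.mul_apply]
    refine Finset.sum_eq_single i (fun l _ hl ↦ ?_) (by simp)
    rcases lt_or_gt_of_ne hl with h' | h'
    · rw [hρ g i l h', zero_mul]
    · rw [hρ h l i h', mul_zero]
  have hsucc : ∀ d, 0 < d → HasCongruenceProperty K (unipotentFiltration ρ hρ (d + 1)) →
      HasCongruenceProperty K (unipotentFiltration ρ hρ d) := by
    intro d hd h
    have hy : ∀ (g : Γ) (i j : Fin m), ∃ y : 𝓞 L, (D : L) * (ρ g - 1) i j = algebraMap (𝓞 L) L y := fun g i j ↦ by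
      simpa using hcong 1 one_pos g (hK1 ▸ Subgroup.mem_top g) i j
    choose y hy using hy
    let φ : unipotentFiltration ρ hρ d →*
        Multiplicative ({p : Fin m × Fin m // (p.2 : ℕ) = p.1 + d} → 𝓞 L) :=
      MonoidHom.mk' (fun g ↦ Multiplicative.ofAdd fun p ↦ y g p.1.1 p.1.2) (by
        intro g h
        rw [← ofAdd_add]
        congr 1
        funext p
        apply RingOfIntegers.coe_injective
        rw [Pi.add_apply, map_add, ← hy, ← hy, ← hy, Subgroup.coe_mul, map_mul_sub_one,
          Matrix.add_apply, Matrix.add_apply,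
          mul_apply_eq_zero_of_band g.2 h.2 (by have := p.2; omega)]
        ring)
    refine h.of_ker hK hfin (fun g hg i j hij ↦ mem_unipotentFiltration.1 hg i j (by omega)) φ ?_ ?_
    · intro g hg i j hij
      rcases lt_or_eq_of_le (Nat.lt_succ_iff.1 hij) with h' | h'
      · exact g.2 i j h'
      · have h0 : y g i j = 0 := congrFun (congrArg Multiplicative.toAdd hg) ⟨(i, j), h'⟩
        have := hy g i j
        rw [h0, map_zero] at this
        exact (mul_eq_zero.1 this).resolve_left hD0
    · intro B hB
      obtain ⟨e, he, hB⟩ := AddSubgroup.exists_forall_nsmul_mem (Subgroup.toAddSubgroup' B)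
        (Subgroup.toAddSubgroup' φ.range) hB
      refine ⟨e, he, fun g hg ↦ ?_⟩
      choose z hz using hcong e he g hg
      have hφ : (φ g).toAdd = e • fun p ↦ z p.1.1 p.1.2 := by
        funext p
        apply RingOfIntegers.coe_injective
        rw [Pi.smul_apply, map_nsmul, nsmul_eq_mul, ← hz, hy]
        rfl
      have := hB (fun p ↦ z p.1.1 p.1.2) (by rw [← hφ]; exact ⟨g, rfl⟩)
      rw [← hφ] at this
      exact this
  have hlast : HasCongruenceProperty K (unipotentFiltration ρ hρ (m + 1)) := by
    refine fun Λ _ ↦ ⟨1, one_pos, fun g hg ↦ ?_⟩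
    obtain rfl : g = 1 := hinj (by
      rw [map_one, ← sub_eq_zero]
      ext i j
      exact hg.2 i j (by omega))
    exact Λ.one_mem
  have hone : HasCongruenceProperty K (unipotentFiltration ρ hρ 1) :=
    Nat.decreasingInduction' (n := m + 1) (m := 1)
      (P := fun d ↦ HasCongruenceProperty K (unipotentFiltration ρ hρ d))
      (fun d _ hd ↦ hsucc d hd) (by omega) hlast
  choose u hu using hunit
  let φ : (⊤ : Subgroup Γ) →* (Fin m → (𝓞 L)ˣ) := MonoidHom.mk' (fun g ↦ u g) (by
    intro g h
    funext i
    apply Units.ext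
    apply RingOfIntegers.coe_injective
    rw [Pi.mul_apply, Units.val_mul, map_mul]
    rw [hu, hu, hu, Subgroup.coe_mul, hdiag])
  refine hone.of_ker hK hfin le_top φ ?_ ?_
  · intro g hg i j hij
    rcases lt_or_eq_of_le (Nat.lt_succ_iff.1 hij) with h' | h'
    · rw [Matrix.sub_apply, hρ _ i j (Fin.lt_def.2 h'), Matrix.one_apply_ne (Fin.ne_of_gt h'),
        sub_zero]
    · obtain rfl : j = i := Fin.ext h'
      have : u g j = 1 := congrFun hg j
      rw [Matrix.sub_apply, ← hu, this, Matrix.one_apply_eq]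
      simp
  · intro B hB
    obtain ⟨n, hn, hB⟩ := exists_modulus_forall_units_mem B φ.range hB
    refine ⟨D * n, by positivity, fun g hg ↦ hB _ ⟨g, rfl⟩ fun i ↦ ?_⟩
    obtain ⟨y, hy⟩ := hcong _ (by positivity) g hg i i
    refine ⟨y, RingOfIntegers.coe_injective ?_⟩
    rw [Matrix.sub_apply, Matrix.one_apply_eq, ← hu, Nat.cast_mul, mul_assoc] at hy
    change algebraMap (𝓞 L) L (u g i - 1) = _
    simpa using mul_left_cancel₀ hD0 hy

theorem isIntegral_of_isRoot_charpoly_map {R F n : Type*} [CommRing R] [Algebra.IsIntegral ℤ R]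
    [Field F] [Fintype n] [DecidableEq n] (f : R →+* F) (A : Matrix n n R) {μ : F}
    (h : (A.map f).charpoly.IsRoot μ) : IsIntegral ℤ μ := by
  let := f.toAlgebra
  refine isIntegral_trans (A := R) μ ⟨A.charpoly, A.charpoly_monic, ?_⟩
  rw [Matrix.charpoly_map, Polynomial.IsRoot, Polynomial.eval_map] at h
  exact h

theorem isIntegral_of_mulVec_eq_smul {R F n : Type*} [CommRing R] [Algebra.IsIntegral ℤ R]
    [Field F] [Fintype n] [DecidableEq n] (f : R →+* F) (A : Matrix n n R) {μ : F} {v : n → F}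
    (hv : v ≠ 0) (h : (A.map f).mulVec v = μ • v) : IsIntegral ℤ μ := by
  refine isIntegral_of_isRoot_charpoly_map f A ?_
  rw [← Matrix.charpoly_toLin', ← Module.End.hasEigenvalue_iff_isRoot_charpoly]
  exact hasEigenvalue_of_apply_eq_smul hv (by rwa [Matrix.toLin'_apply])

/-- The linear action of an invertible matrix over `R` on vectors over an `R`-algebra. -/
def mulVecAction {R F n : Type*} [CommRing R] [Field F] [Fintype n] [DecidableEq n]
    (f : R →+* F) : Matrix.GeneralLinearGroup n R →* Module.End F (n → F) :=
  (Matrix.toLinAlgEquiv' : Matrix n n F ≃ₐ[F] _).toMonoidHom.comp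
    ((Units.coeHom _).comp (Matrix.GeneralLinearGroup.map f))

theorem mulVecAction_apply {R F n : Type*} [CommRing R] [Field F] [Fintype n] [DecidableEq n]
    (f : R →+* F) (g : Matrix.GeneralLinearGroup n R) (v : n → F) :
    mulVecAction f g v = ((g : Matrix n n R).map f).mulVec v := rfl

theorem isNeat_mulVecAction {R F n : Type*} [CommRing R] [Algebra.IsIntegral ℤ R]
    [Field F] [CharZero F] [Fintype n] [DecidableEq n] (f : R →+* F)
    (Γ : Subgroup (Matrix.GeneralLinearGroup n R))
    (hΓ : ∀ g ∈ Γ, ∃ A : Matrix n n R, (g : Matrix n n R) = 1 + (6 : R) • A) :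
    IsNeat ((mulVecAction f).comp Γ.subtype) := by
  intro g μ ζ d hd hζ hμ hζμ
  obtain ⟨A, hA⟩ := hΓ g g.2
  have hint : ∀ c : F, ((mulVecAction f).comp Γ.subtype g).HasEigenvalue c →
      IsIntegral ℤ ((c - 1) / 6) := by
    intro c hc
    obtain ⟨v, hv⟩ := hc.exists_hasEigenvector
    refine isIntegral_of_mulVec_eq_smul f A hv.2 ?_
    have h := hv.apply_eq_smul
    rw [MonoidHom.comp_apply, Subgroup.subtype_apply, mulVecAction_apply, hA, Matrix.map_add _ (map_add f),
      Matrix.map_one _ f.map_zero f.map_one, Matrix.map_smul' _ _ _ (map_mul f), Matrix.add_mulVec, Matrix.one_mulVec,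
      Matrix.smul_mulVec, map_ofNat] at h
    rw [div_eq_inv_mul, mul_smul, sub_smul, one_smul, ← h, add_sub_cancel_left, smul_smul,
      inv_mul_cancel₀ (by norm_num), one_smul]
  have hμ0 : μ ≠ 0 := by
    rintro rfl
    obtain ⟨v, hv⟩ := hμ.exists_hasEigenvector
    exact map_apply_ne_zero _ g hv.2 (by rw [hv.apply_eq_smul, zero_smul])
  have hinv : IsIntegral ℤ μ⁻¹ := by
    obtain ⟨v, hv⟩ := hμ.exists_hasEigenvector
    have h := hv.apply_eq_smul
    refine isIntegral_of_mulVec_eq_smul f ((g⁻¹ : Γ) : Matrix.GeneralLinearGroup n R).1 hv.2 ?_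
    have h' := map_inv_apply_map_apply ((mulVecAction f).comp Γ.subtype) g v
    rw [h, map_smul] at h'
    conv_rhs => rw [← h', smul_smul, inv_mul_cancel₀ hμ0, one_smul]
    rfl
  refine eq_one_of_sub_one_eq_six_mul hd hζ (((hint _ hζμ).sub (hint _ hμ)).mul hinv) ?_
  field_simp
  ring

theorem exists_intermediateField_triangular {R k F : Type*} [CommRing R] [Field k] [Field F]
    [Algebra R k] [Algebra k F] [IsAlgClosed F] [CharZero F] [Algebra.IsAlgebraic k F] {m : ℕ}
    (Γ : Subgroup (Matrix.GeneralLinearGroup (Fin m) R)) [Group.IsSolvable Γ]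
    (hΓ : IsNeat ((mulVecAction ((algebraMap k F).comp (algebraMap R k))).comp Γ.subtype)) :
    ∃ (L : IntermediateField k F) (_ : FiniteDimensional k L)
      (P : Matrix.GeneralLinearGroup (Fin m) L), ∀ g ∈ Γ, ∀ i j : Fin m, j < i →
        (P⁻¹ * Matrix.GeneralLinearGroup.map ((algebraMap k L).comp (algebraMap R k)) g * P) i j
          = 0 := by
  obtain ⟨w, hw, hspan⟩ := hΓ.exists_triangular m (by simp)
  let s : Set F := Set.range fun p : Fin m × Fin m ↦ w p.1 p.2
  have : Finite s := Set.finite_range _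
  let L := IntermediateField.adjoin k s
  have hfin : FiniteDimensional k L :=
    IntermediateField.finiteDimensional_adjoin fun x _ ↦ (Algebra.IsAlgebraic.isAlgebraic x).isIntegral
  let Q : Matrix (Fin m) (Fin m) L := Matrix.of fun i j ↦
    ⟨w j i, IntermediateField.subset_adjoin k s ⟨(j, i), rfl⟩⟩
  have hQ : IsUnit (Q.map (algebraMap L F)) :=
    Matrix.linearIndependent_cols_iff_isUnit.1 hw
  have hdet : Q.det ≠ 0 := fun h ↦ by
    rw [Matrix.isUnit_iff_isUnit_det, ← RingHom.mapMatrix_apply, ← RingHom.map_det, h, map_zero] at hQ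
    exact not_isUnit_zero hQ
  let P := Matrix.GeneralLinearGroup.mkOfDetNeZero Q hdet
  refine ⟨L, hfin, P, fun g hg i j hij ↦ ?_⟩
  let PF := Matrix.GeneralLinearGroup.map (algebraMap L F) P
  have hPw : ∀ l, PF.1.mulVec (Pi.single l 1) = w l := fun l ↦ by
    rw [Matrix.mulVec_single_one]; rfl
  let ℓ : (Fin m → F) →ₗ[F] F := (LinearMap.proj i).comp (Matrix.toLin' PF⁻¹.1)
  have hℓ : Submodule.span F (w '' Set.Iic j) ≤ LinearMap.ker ℓ := by
    rw [Submodule.span_le]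
    rintro _ ⟨l, hl, rfl⟩
    rw [SetLike.mem_coe, LinearMap.mem_ker, LinearMap.comp_apply, Matrix.toLin'_apply, ← hPw,
      Matrix.mulVec_mulVec, ← Units.val_mul, inv_mul_cancel, Units.val_one, Matrix.one_mulVec]
    exact Pi.single_eq_of_ne (ne_of_gt (lt_of_le_of_lt hl hij)) _
  have h := hℓ (hspan ⟨g, hg⟩ j)
  rw [LinearMap.mem_ker, LinearMap.comp_apply, Matrix.toLin'_apply, MonoidHom.comp_apply,
    mulVecAction_apply, ← hPw, Matrix.mulVec_mulVec, Matrix.mulVec_mulVec,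
    Matrix.mulVec_single_one] at h
  apply (algebraMap L F).injective
  rw [map_zero, ← Matrix.GeneralLinearGroup.map_apply, map_mul, map_mul, map_inv,
    mul_assoc]
  rw [mul_assoc] at h
  exact h

/-- The principal congruence subgroup of level `n`. -/
def congruenceKernel (R : Type*) [CommRing R] (m n : ℕ) :
    Subgroup (Matrix.GeneralLinearGroup (Fin m) R) :=
  (Matrix.GeneralLinearGroup.map (Ideal.Quotient.mk (Ideal.span {(n : R)}))).ker

theorem mem_congruenceKernel {R : Type*} [CommRing R] {m n : ℕ}
    {g : Matrix.GeneralLinearGroup (Fin m) R} :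
    g ∈ congruenceKernel R m n ↔ ∃ A : Matrix (Fin m) (Fin m) R,
      (g : Matrix (Fin m) (Fin m) R) = 1 + (n : R) • A := by
  have key : g ∈ congruenceKernel R m n ↔ ∀ i j : Fin m, (n : R) ∣ g i j - (1 : Matrix _ _ R) i j := by
    rw [congruenceKernel, MonoidHom.mem_ker, Matrix.GeneralLinearGroup.ext_iff]
    refine forall_congr' fun i ↦ forall_congr' fun j ↦ ?_
    rw [← Ideal.mem_span_singleton, ← Ideal.Quotient.eq_zero_iff_mem, map_sub, sub_eq_zero,
      Matrix.GeneralLinearGroup.map_apply, Units.val_one,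
      ← Matrix.map_one (Ideal.Quotient.mk (Ideal.span {(n : R)})) (map_zero _) (map_one _),
      Matrix.map_apply]
  rw [key]
  constructor
  · intro h
    choose A hA using h
    refine ⟨Matrix.of A, ?_⟩
    ext i j
    rw [Matrix.add_apply, Matrix.smul_apply, Matrix.of_apply, smul_eq_mul, ← hA,
      add_sub_cancel]
  · rintro ⟨A, hA⟩ i j
    exact ⟨A i j, by simp [hA]⟩

theorem congruenceKernel_one (R : Type*) [CommRing R] (m : ℕ) : congruenceKernel R m 1 = ⊤ :=
  eq_top_iff.2 fun g _ ↦ mem_congruenceKernel.2 ⟨g - 1, by simp⟩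

theorem congruenceKernel_mul_le (R : Type*) [CommRing R] (m a b : ℕ) :
    congruenceKernel R m (a * b) ≤ congruenceKernel R m a ⊓ congruenceKernel R m b := by
  intro g hg
  obtain ⟨A, hA⟩ := mem_congruenceKernel.1 hg
  refine ⟨mem_congruenceKernel.2 ⟨(b : R) • A, ?_⟩, mem_congruenceKernel.2 ⟨(a : R) • A, ?_⟩⟩
  · rw [hA, smul_smul, Nat.cast_mul]
  · rw [hA, smul_smul, Nat.cast_mul, mul_comm]

theorem congruenceKernel_finiteIndex (k : Type*) [Field k] [NumberField k] (m : ℕ) {n : ℕ}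
    (hn : 0 < n) : (congruenceKernel (𝓞 k) m n).FiniteIndex := by
  have : Finite (𝓞 k ⧸ Ideal.span {(n : 𝓞 k)}) :=
    Ideal.finiteQuotientOfFreeOfNeBot _ (by simpa using hn.ne')
  exact Subgroup.finiteIndex_ker _

theorem hasCongruenceProperty_of_isSolvable {k : Type*} [Field k] [NumberField k] {m : ℕ}
    (Γ : Subgroup (Matrix.GeneralLinearGroup (Fin m) (𝓞 k))) [Group.IsSolvable Γ]
    (hΓ : Γ ≤ congruenceKernel (𝓞 k) m 6) :
    HasCongruenceProperty (fun n ↦ (congruenceKernel (𝓞 k) m n).subgroupOf Γ) ⊤ := by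
  obtain ⟨L, hL, P, hP⟩ := exists_intermediateField_triangular (k := k) (F := AlgebraicClosure k) Γ
    (isNeat_mulVecAction _ Γ fun g hg ↦ mem_congruenceKernel.1 (hΓ hg))
  have : NumberField L :=
    { to_charZero := inferInstance
      to_finiteDimensional := FiniteDimensional.trans ℚ k L }
  let f : 𝓞 k →+* L := (algebraMap k L).comp (algebraMap (𝓞 k) k)
  have hf : Function.Injective f :=
    (algebraMap k L).injective.comp RingOfIntegers.coe_injective
  let ρ : Γ →* Matrix (Fin m) (Fin m) L :=
    (Units.coeHom _).comp ((MulAut.conj P⁻¹).toMonoidHom.comp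
      ((Matrix.GeneralLinearGroup.map f).comp Γ.subtype))
  have hρg : ∀ g : Γ, ρ g = P⁻¹.1 * (g : Matrix.GeneralLinearGroup (Fin m) (𝓞 k)).1.map f * P.1 := by
    intro g
    change (P⁻¹ * Matrix.GeneralLinearGroup.map f g * P⁻¹⁻¹).1 = _
    rw [inv_inv]; rfl
  have htri : ∀ (g : Γ) (i j : Fin m), j < i → ρ g i j = 0 := by
    intro g i j hij
    rw [hρg]
    exact hP g g.2 i j hij
  have hinj : Function.Injective ρ := by
    refine Units.val_injective.comp ((MulAut.conj P⁻¹).injective.comp ?_)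
    exact fun g h hgh ↦ Subtype.ext (Units.ext (Matrix.map_injective hf (congrArg Units.val hgh)))
  have hint : ∀ (g : Γ) (i : Fin m), IsIntegral ℤ (ρ g i i) := by
    intro g i
    refine isIntegral_of_isRoot_charpoly_map f (g : Matrix.GeneralLinearGroup (Fin m) (𝓞 k)).1 ?_
    have h1 : (ρ g).charpoly = ((g : Matrix.GeneralLinearGroup (Fin m) (𝓞 k)).1.map f).charpoly := by
      rw [hρg, ← Matrix.charpoly_units_conj P⁻¹]
      simp
    rw [← h1, Matrix.charpoly_of_isUpperTriangular (ρ g) (fun i j hij ↦ htri g i j hij),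
      Polynomial.IsRoot, Polynomial.eval_prod]
    exact Finset.prod_eq_zero (Finset.mem_univ i) (by simp)
  have hdiag : ∀ (g : Γ) (i : Fin m), ρ g i i * ρ g⁻¹ i i = 1 := by
    intro g i
    have h := congrFun (congrFun (map_mul ρ g g⁻¹) i) i
    rw [mul_inv_cancel, map_one, Matrix.one_apply_eq, Matrix.mul_apply,
      Finset.sum_eq_single i (fun l _ hl ↦ ?_) (by simp)] at h
    · exact h.symm
    · rcases lt_or_gt_of_ne hl with h' | h'
      · rw [htri g i l h', zero_mul]
      · rw [htri _ l i h', mul_zero]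
  classical
  obtain ⟨D, hD, hDint⟩ := exists_integral_multiples ℤ ℚ
    (Finset.univ.image fun p : (Fin m × Fin m) × Fin m × Fin m ↦
      P⁻¹.1 p.1.1 p.1.2 * P.1 p.2.1 p.2.2)
  have hDint' : ∀ a b c d : Fin m, ∃ y : 𝓞 L,
      (D.natAbs : L) * (P⁻¹.1 a b * P.1 c d) = algebraMap (𝓞 L) L y := by
    intro a b c d
    have h := hDint _ (Finset.mem_image_of_mem _ (Finset.mem_univ ((a, b), c, d)))
    rw [zsmul_eq_mul] at h
    have h2 : IsIntegral ℤ ((D.natAbs : L) * (P⁻¹.1 a b * P.1 c d)) := by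
      rcases Int.natAbs_eq D with h' | h'
      · rw [h'] at h
        simpa using h
      · rw [h'] at h
        simpa using h.neg
    exact ⟨⟨_, h2⟩, rfl⟩
  refine hasCongruenceProperty_of_triangular ?_ ?_ ?_ ρ hinj htri ?_ (Int.natAbs_pos.2 hD) ?_
  · rw [congruenceKernel_one, Subgroup.subgroupOf_eq_top]
    exact le_top
  · intro a b
    exact fun g hg ↦ congruenceKernel_mul_le _ _ _ _ hg
  · intro n hn
    have := congruenceKernel_finiteIndex k m hn
    infer_instance
  · intro g i
    exact ⟨⟨⟨_, hint g i⟩, ⟨_, hint g⁻¹ i⟩, RingOfIntegers.coe_injective (hdiag g i),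
      RingOfIntegers.coe_injective ((mul_comm _ _).trans (hdiag g i))⟩, rfl⟩
  · intro n hn g hg i j
    obtain ⟨A, hA⟩ := mem_congruenceKernel.1 hg
    choose y hy using hDint'
    let f' : 𝓞 k →+* 𝓞 L := RingOfIntegers.mapRingHom (algebraMap k L)
    refine ⟨∑ b, ∑ a, y i a b j * f' (A a b), ?_⟩
    have h1 : ρ g - 1 = (n : L) • (P⁻¹.1 * A.map f * P.1) := by
      rw [hρg]
      change P⁻¹.1 * ((g : Matrix.GeneralLinearGroup (Fin m) (𝓞 k)) : Matrix _ _ _).map f * P.1 - 1 = _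
      erw [hA]
      rw [Matrix.map_add _ (map_add f),
        Matrix.map_one _ f.map_zero f.map_one, Matrix.map_smul' _ _ _ (map_mul f), map_natCast,
        mul_add, add_mul, mul_one, ← Units.val_mul, inv_mul_cancel, Units.val_one,
        add_sub_cancel_left, Matrix.mul_smul, Matrix.smul_mul]
    rw [h1, Matrix.smul_apply, smul_eq_mul, mul_left_comm, map_sum, Matrix.mul_apply, Finset.mul_sum]
    congr 1
    refine Finset.sum_congr rfl fun b _ ↦ ?_
    rw [map_sum, Matrix.mul_apply, Finset.sum_mul, Finset.mul_sum]
    refine Finset.sum_congr rfl fun a _ ↦ ?_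
    rw [map_mul, ← hy, Matrix.map_apply]
    change _ = _ * f (A a b)
    ring

open Matrix NumberField

theorem stmt7 (k : Type*) [Field k] [NumberField k] (σ : k →+* ℂ) (m : ℕ)
    (H : Subgroup (GL (Fin m) ℂ)) (hsolv : IsSolvable H)
    (S : Set (MvPolynomial (Fin m × Fin m) k))
    (hH : ∀ g : GL (Fin m) ℂ, g ∈ H ↔
      ∀ P ∈ S, MvPolynomial.eval
        (fun ij : Fin m × Fin m => (g : Matrix (Fin m) (Fin m) ℂ) ij.1 ij.2)
        (MvPolynomial.map σ P) = 0)
    -- `HOk` is the group of `g ∈ GL(m, O_k)` whose image under entrywise `σ` lies in `H`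
    (HOk : Subgroup (GL (Fin m) (𝓞 k)))
    (hHOk : HOk = H.comap
      (Matrix.GeneralLinearGroup.map (σ.comp (algebraMap (𝓞 k) k)) :
        GL (Fin m) (𝓞 k) →* GL (Fin m) ℂ))
    (Λ : Subgroup HOk) (hΛ : Λ.FiniteIndex) :
    ∃ 𝔭 : Ideal (𝓞 k), 𝔭 ≠ ⊥ ∧
      ∀ g : HOk,
        Matrix.GeneralLinearGroup.map (Ideal.Quotient.mk 𝔭) (g : GL (Fin m) (𝓞 k)) = 1 →
        g ∈ Λ := by
  let τ : 𝓞 k →+* ℂ := σ.comp (algebraMap (𝓞 k) k)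
  have hτ : Function.Injective τ := σ.injective.comp RingOfIntegers.coe_injective
  let Γ := HOk ⊓ congruenceKernel (𝓞 k) m 6
  let ι : Γ →* H := ((GeneralLinearGroup.map τ).comp Γ.subtype).codRestrict H fun g ↦ by
    have := g.2.1
    rw [hHOk] at this
    exact this
  have hι : Function.Injective ι := fun g h hgh ↦
    Subtype.ext (Units.ext (Matrix.map_injective hτ (congrArg (fun x : H ↦ x.1.1) hgh)))
  have : Group.IsSolvable H := hsolv
  have : Group.IsSolvable Γ := Group.isSolvable_of_isSolvable_injective hι
  obtain ⟨n, hn, hnΛ⟩ := hasCongruenceProperty_of_isSolvable Γ inf_le_right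
    (Λ.comap (Subgroup.inclusion inf_le_left)) (by
      rw [Subgroup.relIndex_top_right, Subgroup.index_comap]
      exact Subgroup.FiniteIndex.index_ne_zero (H := Λ.subgroupOf _))
  refine ⟨Ideal.span {((6 * n : ℕ) : 𝓞 k)}, by simpa using hn.ne', fun g hg ↦ ?_⟩
  have hg' := congruenceKernel_mul_le (𝓞 k) m 6 n hg
  exact hnΛ (x := ⟨g, g.2, hg'.1⟩) ⟨hg'.2, Subgroup.mem_top _⟩
end

section
/- Let p be an odd prime and let k be an imaginary quadratic field, i.e., a subfield of ℂ with [k : ℚ] = 2 that is not contained in ℝ. If there exists an injective group homomorphism from the cyclic group of order p into GL((p−1)/2, k), then p ≡ 3 (mod 4). -/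
open Matrix

open Polynomial IntermediateField in
/-- A matrix of prime order `p` over `K` has an eigenvalue which is a primitive `p`-th root of
unity, so such a root has degree at most the size of the matrix over `K`. -/
theorem exists_isPrimitiveRoot_natDegree_minpoly_le {K L : Type*} [Field K] [Field L] [CharZero L]
    [IsAlgClosed L] [Algebra K L] {p m : ℕ} (hp : p.Prime) (M : Matrix (Fin m) (Fin m) K)
    (hM : M ^ p = 1) (hM1 : M ≠ 1) :
    ∃ ζ : L, IsPrimitiveRoot ζ p ∧ (minpoly K ζ).natDegree ≤ m := by
  have : Fact p.Prime := ⟨hp⟩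
  have : NeZero (p : L) := ⟨Nat.cast_ne_zero.mpr hp.ne_zero⟩
  have hncop : ¬ IsCoprime (minpoly K M) (cyclotomic p K) := by
    intro hcop
    have hdvd : minpoly K M ∣ cyclotomic p K * (X - 1) := by
      rw [cyclotomic_prime_mul_X_sub_one]
      exact minpoly.dvd K M (by simp [hM])
    obtain ⟨q, hq⟩ := hcop.dvd_of_dvd_mul_left hdvd
    have h : aeval M (X - 1 : K[X]) = 0 := by rw [hq, map_mul, minpoly.aeval, zero_mul]
    exact hM1 (sub_eq_zero.mp (by simpa using h))
  rw [isCoprime_iff_aeval_ne_zero_of_isAlgClosed K L] at hncop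
  push Not at hncop
  obtain ⟨ζ, hζM, hζ⟩ := hncop
  refine ⟨ζ, ?_, ?_⟩
  · rw [← isRoot_cyclotomic_iff, IsRoot, ← map_cyclotomic p (algebraMap K L), eval_map_algebraMap]
    exact hζ
  · have hdvd : minpoly K ζ ∣ M.charpoly :=
      (minpoly.dvd K ζ hζM).trans M.minpoly_dvd_charpoly
    simpa using natDegree_le_of_dvd hdvd M.charpoly_monic.ne_zero

open Polynomial in
/-- An endomorphism permutes the at most two roots of a polynomial of degree at most two, so its
square fixes them. -/
theorem algHom_apply_apply_of_natDegree_minpoly_le_two {F L : Type*} [Field F] [Field L]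
    [Algebra F L] (σ : L →ₐ[F] L) {x : L} (hx : IsIntegral F x)
    (hdeg : (minpoly F x).natDegree ≤ 2) : σ (σ x) = x := by
  classical
  by_contra hne
  have h1 : σ x ≠ x := fun h => hne (by rw [h, h])
  have h2 : σ (σ x) ≠ σ x := fun h => h1 (σ.injective h)
  have hroot : ∀ y, aeval y (minpoly F x) = 0 → y ∈ (minpoly F x).aroots L := fun y hy =>
    mem_aroots.mpr ⟨minpoly.ne_zero hx, hy⟩
  have hσ : ∀ y, aeval y (minpoly F x) = 0 → aeval (σ y) (minpoly F x) = 0 := fun y hy => by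
    rw [aeval_algHom_apply, hy, map_zero]
  have hx0 := minpoly.aeval F x
  have hsub : ({x, σ x, σ (σ x)} : Finset L) ⊆ ((minpoly F x).aroots L).toFinset := by
    intro y hy
    simp only [Finset.mem_insert, Finset.mem_singleton] at hy
    rw [Multiset.mem_toFinset]
    rcases hy with rfl | rfl | rfl
    · exact hroot _ hx0
    · exact hroot _ (hσ _ hx0)
    · exact hroot _ (hσ _ (hσ _ hx0))
  have hcard : ({x, σ x, σ (σ x)} : Finset L).card = 3 :=
    Finset.card_eq_three.mpr ⟨_, _, _, h1.symm, Ne.symm hne, h2.symm, rfl⟩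
  have hle := (Finset.card_le_card hsub).trans (Multiset.toFinset_card_le _)
  have hle' := (card_roots' ((minpoly F x).map (algebraMap F L))).trans natDegree_map_le
  rw [hcard] at hle
  exact absurd (hle.trans hle') (by omega)

open Polynomial IntermediateField in
/-- If `p ≡ 1 [MOD 4]`, complex conjugation is a square in the Galois group of the `p`-th cyclotomic
field. -/
theorem exists_algHom_apply_apply_eq_conj {p : ℕ} (hp : p.Prime) (hp4 : p % 4 = 1) {ζ : ℂ}
    (hζ : IsPrimitiveRoot ζ p) :
    ∃ σ : ℚ⟮ζ⟯ →ₐ[ℚ] ℚ⟮ζ⟯, ∀ x, (σ (σ x) : ℂ) = starRingEnd ℂ x := by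
  have : Fact p.Prime := ⟨hp⟩
  have hint : IsIntegral ℚ ζ := (hζ.isIntegral hp.pos).tower_top
  obtain ⟨b, hb⟩ := ZMod.exists_sq_eq_neg_one_iff.mpr (show p % 4 ≠ 3 by omega)
  have hdvd : p ∣ b.val * b.val + 1 := by
    rw [← ZMod.natCast_eq_zero_iff]
    simp [← hb]
  have hcop : b.val.Coprime p := by
    rw [Nat.coprime_comm, hp.coprime_iff_not_dvd]
    intro h
    exact hp.one_lt.ne' (Nat.dvd_one.mp ((Nat.dvd_add_right (h.mul_left _)).mp hdvd))
  have hroot : AdjoinSimple.gen ℚ ζ ^ b.val ∈ (minpoly ℚ ζ).aroots ℚ⟮ζ⟯ := by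
    refine mem_aroots.mpr ⟨minpoly.ne_zero hint, ?_⟩
    apply (algebraMap ℚ⟮ζ⟯ ℂ).injective
    rw [← aeval_algebraMap_apply, map_pow, AdjoinSimple.algebraMap_gen, map_zero,
      ← cyclotomic_eq_minpoly_rat hζ hp.pos, cyclotomic_eq_minpoly_rat
        (hζ.pow_of_coprime _ hcop) hp.pos, minpoly.aeval]
  let σ := (algHomAdjoinIntegralEquiv ℚ hint).symm ⟨_, hroot⟩
  have hσ : σ (AdjoinSimple.gen ℚ ζ) = AdjoinSimple.gen ℚ ζ ^ b.val :=
    algHomAdjoinIntegralEquiv_symm_apply_gen ℚ hint _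
  have hconj : starRingEnd ℂ ζ = ζ ^ (b.val * b.val) := by
    rw [← Complex.inv_eq_conj (hζ.norm'_eq_one hp.ne_zero)]
    apply inv_eq_of_mul_eq_one_right
    rw [← pow_succ']
    exact (hζ.pow_eq_one_iff_dvd _).mpr hdvd
  have heq : (ℚ⟮ζ⟯.val.comp σ).comp σ =
      (Complex.conjAe.toAlgHom.restrictScalars ℚ).comp ℚ⟮ζ⟯.val := by
    refine algHom_ext_of_eq_adjoin _ rfl fun x hx => ?_
    obtain rfl : x = ζ := hx
    change ((σ (σ (AdjoinSimple.gen ℚ x)) : ℚ⟮x⟯) : ℂ) = starRingEnd ℂ x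
    rw [hσ, map_pow, hσ, hconj, ← pow_mul]
    simp
  exact ⟨σ, fun x => DFunLike.congr_fun heq x⟩

open IntermediateField in
/-- If a primitive `p`-th root of unity has degree at most `(p - 1) / 2` over a quadratic field `k`,
then `k` is contained in the `p`-th cyclotomic field. -/
theorem mem_adjoin_of_natDegree_minpoly_le {p : ℕ} (hp : p.Prime) {k : Subfield ℂ}
    (hdeg : Module.finrank ℚ k = 2) {ζ : ℂ} (hζ : IsPrimitiveRoot ζ p)
    (hle : (minpoly k ζ).natDegree ≤ (p - 1) / 2) {x : ℂ} (hx : x ∈ k) : x ∈ ℚ⟮ζ⟯ := by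
  have hintQ : IsIntegral ℚ ζ := (hζ.isIntegral hp.pos).tower_top
  have hint : IsIntegral k ζ := hintQ.tower_top
  have : FiniteDimensional ℚ k := Module.finite_of_finrank_pos (by omega)
  have : FiniteDimensional k k⟮ζ⟯ := adjoin.finiteDimensional hint
  let E : IntermediateField ℚ ℂ := k⟮ζ⟯.restrictScalars ℚ
  have : FiniteDimensional ℚ E := Module.Finite.trans (R := ℚ) k k⟮ζ⟯
  have hE : Module.finrank ℚ E ≤ p - 1 := by
    have h : Module.finrank ℚ k * Module.finrank k k⟮ζ⟯ = Module.finrank ℚ E :=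
      Module.finrank_mul_finrank ℚ k k⟮ζ⟯
    rw [hdeg, adjoin.finrank hint] at h
    omega
  have hQ : Module.finrank ℚ ℚ⟮ζ⟯ = p - 1 := by
    rw [adjoin.finrank hintQ, ← Polynomial.cyclotomic_eq_minpoly_rat hζ hp.pos,
      Polynomial.natDegree_cyclotomic, Nat.totient_prime hp]
  have hsub : ℚ⟮ζ⟯ ≤ E := adjoin_simple_le_iff.mpr (mem_adjoin_simple_self k ζ)
  rw [eq_of_le_of_finrank_le hsub (hE.trans hQ.ge)]
  exact k⟮ζ⟯.algebraMap_mem ⟨x, hx⟩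

theorem stmt8 (p : ℕ) (hp : p.Prime) (hodd : Odd p)
    (k : Subfield ℂ) (hdeg : Module.finrank ℚ k = 2)
    (himag : ¬ (k : Set ℂ) ⊆ Set.range (Complex.ofReal))
    (f : Multiplicative (ZMod p) →* GL (Fin ((p - 1) / 2)) k)
    (hf : Function.Injective f) :
    p % 4 = 3 := by
  by_contra hp4
  have hp1 : p % 4 = 1 := by
    have := Nat.odd_iff.mp hodd
    omega
  have : Fact p.Prime := ⟨hp⟩
  let g : Multiplicative (ZMod p) := Multiplicative.ofAdd 1
  have hg : g ^ p = 1 := by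
    rw [← ofAdd_nsmul, nsmul_one, ZMod.natCast_self, ofAdd_zero]
  have hg1 : g ≠ 1 := fun h => one_ne_zero (α := ZMod p) (Multiplicative.ofAdd.injective h)
  obtain ⟨ζ, hζ, hle⟩ := exists_isPrimitiveRoot_natDegree_minpoly_le (L := ℂ) hp
    (f g : Matrix (Fin ((p - 1) / 2)) (Fin ((p - 1) / 2)) k)
    (by rw [← Units.val_pow_eq_pow_val, ← map_pow, hg, map_one, Units.val_one])
    (fun h => hg1 (hf (Units.ext (by rw [h, map_one, Units.val_one]))))
  obtain ⟨σ, hσ⟩ := exists_algHom_apply_apply_eq_conj hp hp1 hζ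
  refine himag fun x hx => ?_
  have : FiniteDimensional ℚ k := Module.finite_of_finrank_pos (by omega)
  let y : k := ⟨x, hx⟩
  let z : IntermediateField.adjoin ℚ {ζ} :=
    ⟨x, mem_adjoin_of_natDegree_minpoly_le hp hdeg hζ hle hx⟩
  have hyx : minpoly ℚ x = minpoly ℚ y :=
    minpoly.algebraMap_eq (algebraMap k ℂ).injective y
  have hzx : minpoly ℚ x = minpoly ℚ z :=
    minpoly.algebraMap_eq (algebraMap (IntermediateField.adjoin ℚ {ζ}) ℂ).injective z
  have hz : IsIntegral ℚ z := by
    rw [← minpoly.ne_zero_iff, ← hzx, hyx, minpoly.ne_zero_iff]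
    exact Algebra.IsIntegral.isIntegral y
  have hfix := algHom_apply_apply_of_natDegree_minpoly_le_two σ hz (by
    rw [← hzx, hyx, ← hdeg]
    exact minpoly.natDegree_le y)
  have hreal : starRingEnd ℂ x = x := by
    rw [← hσ z, hfix]
  obtain ⟨r, hr⟩ := Complex.conj_eq_iff_real.mp hreal
  exact ⟨r, hr.symm⟩
end

section
/- Let p be an odd prime, let ζ ∈ ℂ be a primitive p-th root of unity, and let n₁, …, n_{(p−1)/2} be integers at least one of which is not divisible by p. Then the sum ζ^{n₁} + ⋯ + ζ^{n_{(p−1)/2}} is not a rational number. -/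
/-- If `p` is prime, a sum of fewer than `p - 1` powers of a primitive `p`-th root of unity,
not all of them equal to `1`, is irrational. -/
theorem IsPrimitiveRoot.sum_zpow_ne_ratCast {K ι : Type*} [Field K] [CharZero K] [Fintype ι]
    {p : ℕ} (hp : p.Prime) {ζ : K} (hζ : IsPrimitiveRoot ζ p) (n : ι → ℤ)
    (hcard : Fintype.card ι + 1 < p) (hn : ∃ i, ¬ (p : ℤ) ∣ n i) (q : ℚ) :
    ∑ i, ζ ^ n i ≠ (q : K) := by
  classical
  intro hq
  have : NeZero p := ⟨hp.ne_zero⟩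
  have hp0 : (p : ℤ) ≠ 0 := by exact_mod_cast hp.ne_zero
  have hζ0 : ζ ≠ 0 := hζ.ne_zero hp.ne_zero
  have hlift (i : ι) : ∃ j : Fin p, (j.val : ℤ) = n i % p := by
    have h₁ := Int.emod_nonneg (n i) hp0
    have h₂ := Int.emod_lt_of_pos (n i) (by positivity : (0 : ℤ) < p)
    exact ⟨⟨(n i % p).toNat, by lia⟩, by simp [h₁]⟩
  choose r hr using hlift
  have hpow (i : ι) : ζ ^ n i = ζ ^ (r i).val := by
    conv_lhs => rw [← Int.emod_add_mul_ediv (n i) p, ← hr i, zpow_add₀ hζ0, zpow_mul]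
    simp [hζ.pow_eq_one]
  obtain ⟨i₀, hi₀⟩ := hn
  have hr₀ : r i₀ ≠ 0 := by
    intro h
    have := hr i₀
    rw [h] at this
    exact hi₀ (Int.dvd_of_emod_eq_zero (by simpa using this.symm))
  obtain ⟨j, hj⟩ : ∃ j, j ∉ insert 0 (Finset.univ.image r) := by
    by_contra! h
    have h₁ := Finset.card_insert_le 0 (Finset.univ.image r)
    have h₂ : (Finset.univ.image r).card ≤ Fintype.card ι := Finset.card_image_le
    rw [Finset.eq_univ_iff_forall.mpr h, Finset.card_univ, Fintype.card_fin] at h₁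
    lia
  simp only [Finset.mem_insert, Finset.mem_image, Finset.mem_univ, true_and, not_or,
    not_exists] at hj
  let α : Fin p → ℚ := fun k ↦ (∑ i, if r i = k then 1 else 0) - if k = 0 then q else 0
  have hα : ∑ k, (α k : K) * ζ ^ k.val = 0 := by
    simp only [α, Rat.cast_sub, Rat.cast_sum, sub_mul, Finset.sum_sub_distrib, Finset.sum_mul]
    rw [Finset.sum_comm]
    simp [apply_ite (Rat.cast : ℚ → K), ite_mul, ← hpow, hq]
  have heq := (hζ.sum_eq_zero_iff_forall_eq hp α).mp hα (r i₀) j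
  have hαj : α j = 0 := by simp [α, hj]
  have hα₀ : 0 < α (r i₀) := by
    simp only [α, hr₀, if_false, sub_zero]
    exact Finset.sum_pos' (fun _ _ ↦ by split_ifs <;> norm_num) ⟨i₀, Finset.mem_univ _, by simp⟩
  exact hα₀.ne' (heq.trans hαj)

theorem stmt9 (p : ℕ) (hp : p.Prime) (hodd : Odd p)
    (ζ : ℂ) (hζ : IsPrimitiveRoot ζ p)
    (n : Fin ((p - 1) / 2) → ℤ) (hn : ∃ i, ¬ (p : ℤ) ∣ n i) :
    ∀ q : ℚ, (∑ i, ζ ^ n i) ≠ (q : ℂ) := by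
  have hp2 := hp.two_le
  obtain ⟨k, rfl⟩ := hodd
  exact hζ.sum_zpow_ne_ratCast hp n (by rw [Fintype.card_fin]; lia) hn
end

section
/- Let G be a group, let a, b, c ∈ G and let k be a positive integer such that [b, a] = c^k (where [b, a] = b·a·b⁻¹·a⁻¹), c·a = a·c, and c·b = b·c. Let f : G → GL(3, ℂ) be a group homomorphism such that f(a) = ψ(z_a, t_a), f(b) = ψ(z_b, t_b), and f(c) = ψ(0, s) for some z_a, z_b ∈ ℂ, t_a, t_b, s ∈ ℝ. If z_a and z_b are ℤ-linearly independent (i.e., for integers m, n, the relation m·z_a + n·z_b = 0 forces m = n = 0) and s ≠ 0, then the restriction of f to the subgroup of G generated by {a, b, c} is injective. -/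
open Matrix Complex

/-- The matrix `ψ(ξ, t)` realizing the Heisenberg group element `(ξ, t)` in `GL(3, ℂ)`. -/
noncomputable def heisenbergPsi (ξ : ℂ) (t : ℝ) : Matrix (Fin 3) (Fin 3) ℂ :=
  !![1, ξ, ξ;
     -(starRingEnd ℂ ξ), 1 - ((normSq ξ : ℂ) - t * I) / 2, -(((normSq ξ : ℂ) - t * I) / 2);
     starRingEnd ℂ ξ, ((normSq ξ : ℂ) - t * I) / 2, 1 + ((normSq ξ : ℂ) - t * I) / 2]

theorem heisenbergPsi_mul (x y : ℂ) (t u : ℝ) :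
    heisenbergPsi x t * heisenbergPsi y u =
      heisenbergPsi (x + y) (t + u + 2 * (x * starRingEnd ℂ y).im) := by
  have him : ((x * starRingEnd ℂ y).im : ℂ) * I * 2 =
      x * starRingEnd ℂ y - starRingEnd ℂ x * y := by
    apply Complex.ext <;> simp <;> ring
  ext i j
  fin_cases i <;> fin_cases j <;>
    simp [-Complex.mul_im, heisenbergPsi, Matrix.mul_apply, Fin.sum_univ_three,
      Complex.normSq_eq_conj_mul_self] <;>
    first | ring1 | linear_combination -him / 2 | linear_combination him / 2

theorem heisenbergPsi_zero_zero : heisenbergPsi 0 0 = 1 := by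
  ext i j
  fin_cases i <;> fin_cases j <;> simp [heisenbergPsi]

theorem heisenbergPsi_eq_one {x : ℂ} {t : ℝ} (h : heisenbergPsi x t = 1) : x = 0 ∧ t = 0 := by
  have hx : x = 0 := by simpa [heisenbergPsi] using congrFun (congrFun h 0) 1
  subst hx
  exact ⟨rfl, by simpa [heisenbergPsi] using congrFun (congrFun h 2) 1⟩

theorem coe_pow_eq_heisenbergPsi {g : GL (Fin 3) ℂ} {x : ℂ} {t : ℝ}
    (hg : (g : Matrix (Fin 3) (Fin 3) ℂ) = heisenbergPsi x t) (n : ℕ) :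
    ((g ^ n : GL (Fin 3) ℂ) : Matrix (Fin 3) (Fin 3) ℂ) = heisenbergPsi (n * x) (n * t) := by
  induction n with
  | zero => simp [heisenbergPsi_zero_zero]
  | succ n ih =>
    rw [pow_succ, Units.val_mul, ih, hg, heisenbergPsi_mul]
    congr 1
    · push_cast; ring
    · simp; ring

theorem coe_inv_eq_heisenbergPsi {g : GL (Fin 3) ℂ} {x : ℂ} {t : ℝ}
    (hg : (g : Matrix (Fin 3) (Fin 3) ℂ) = heisenbergPsi x t) :
    ((g⁻¹ : GL (Fin 3) ℂ) : Matrix (Fin 3) (Fin 3) ℂ) = heisenbergPsi (-x) (-t) := by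
  refine Units.inv_eq_of_mul_eq_one_right ?_
  rw [hg, heisenbergPsi_mul, ← heisenbergPsi_zero_zero]
  congr 1
  · ring
  · simp; ring

theorem coe_zpow_eq_heisenbergPsi {g : GL (Fin 3) ℂ} {x : ℂ} {t : ℝ}
    (hg : (g : Matrix (Fin 3) (Fin 3) ℂ) = heisenbergPsi x t) (n : ℤ) :
    ((g ^ n : GL (Fin 3) ℂ) : Matrix (Fin 3) (Fin 3) ℂ) = heisenbergPsi (n * x) (n * t) := by
  obtain ⟨n, rfl | rfl⟩ := n.eq_nat_or_neg
  · simpa using coe_pow_eq_heisenbergPsi hg n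
  · simpa using coe_inv_eq_heisenbergPsi (coe_pow_eq_heisenbergPsi hg n)

theorem mul_zpow_eq_of_commutator_eq {G : Type*} [Group G] {a b d : G}
    (hba : b * a * b⁻¹ * a⁻¹ = d) (hda : Commute d a) (m : ℤ) :
    b * a ^ m = d ^ m * a ^ m * b := by
  rw [← hda.mul_zpow, ← hba, inv_mul_cancel_right, conj_zpow, inv_mul_cancel_right]

theorem exists_zpow_mul_zpow_mul_zpow_of_mem_closure {G : Type*} [Group G] {a b c : G} {k : ℕ}
    (hba : b * a * b⁻¹ * a⁻¹ = c ^ k) (hca : Commute c a) (hcb : Commute c b) {x : G}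
    (hx : x ∈ Subgroup.closure {a, b, c}) :
    ∃ m n p : ℤ, x = c ^ p * a ^ m * b ^ n := by
  have hb (m : ℤ) : b * a ^ m = (c ^ k) ^ m * a ^ m * b :=
    mul_zpow_eq_of_commutator_eq hba (hca.pow_left k) m
  have hb' (m : ℤ) : b⁻¹ * a ^ m = (c ^ k) ^ (-m) * a ^ m * b⁻¹ := by
    have hc : b * (c ^ k) ^ (-m) = (c ^ k) ^ (-m) * b := ((hcb.pow_left k).zpow_left (-m)).eq.symm
    rw [inv_mul_eq_iff_eq_mul, ← mul_assoc, ← mul_assoc, hc, mul_assoc _ b, hb]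
    group
  have hk (m : ℤ) : (c ^ k) ^ m = c ^ (k * m : ℤ) := by rw [_root_.zpow_mul, zpow_natCast]
  induction hx using Subgroup.closure_induction_left with
  | one => exact ⟨0, 0, 0, by simp⟩
  | mul_left y hy z hz ih =>
    obtain ⟨m, n, p, rfl⟩ := ih
    obtain rfl | rfl | rfl := hy
    · refine ⟨1 + m, n, p, ?_⟩
      rw [_root_.zpow_one_add, ← mul_assoc, ← mul_assoc, ← mul_assoc, (hca.zpow_left p).eq]
    · refine ⟨m, 1 + n, p + k * m, ?_⟩
      rw [← mul_assoc, ← mul_assoc, ← (hcb.zpow_left p).eq, mul_assoc (c ^ p), hb, hk,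
        _root_.zpow_one_add, _root_.zpow_add]
      simp only [mul_assoc]
    · exact ⟨m, n, 1 + p, by simp only [_root_.zpow_one_add, mul_assoc]⟩
  | inv_mul_cancel y hy z hz ih =>
    obtain ⟨m, n, p, rfl⟩ := ih
    obtain rfl | rfl | rfl := hy
    · refine ⟨-1 + m, n, p, ?_⟩
      rw [_root_.zpow_add, _root_.zpow_neg_one, ← mul_assoc, ← mul_assoc, ← mul_assoc,
        (hca.zpow_left p).inv_right.eq]
    · refine ⟨m, -1 + n, p + k * (-m), ?_⟩
      rw [← mul_assoc, ← mul_assoc, ← (hcb.zpow_left p).inv_right.eq, mul_assoc (c ^ p), hb', hk,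
        _root_.zpow_add _ (-1), _root_.zpow_neg_one, _root_.zpow_add]
      simp only [mul_assoc]
    · exact ⟨m, n, -1 + p, by simp only [_root_.zpow_add _ (-1), _root_.zpow_neg_one, mul_assoc]⟩

theorem stmt14 {G : Type*} [Group G] (a b c : G) (k : ℕ) (hk : 0 < k)
    (hba : b * a * b⁻¹ * a⁻¹ = c ^ k) (hca : c * a = a * c) (hcb : c * b = b * c)
    (f : G →* GL (Fin 3) ℂ) (za zb : ℂ) (ta tb s : ℝ)
    (hfa : (f a : Matrix (Fin 3) (Fin 3) ℂ) = heisenbergPsi za ta)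
    (hfb : (f b : Matrix (Fin 3) (Fin 3) ℂ) = heisenbergPsi zb tb)
    (hfc : (f c : Matrix (Fin 3) (Fin 3) ℂ) = heisenbergPsi 0 s)
    (hindep : ∀ m n : ℤ, (m : ℂ) * za + (n : ℂ) * zb = 0 → m = 0 ∧ n = 0)
    (hs : s ≠ 0) :
    Set.InjOn f (Subgroup.closure {a, b, c} : Subgroup G) := by
  intro x hx y hy hxy
  obtain ⟨m, n, p, h⟩ :=
    exists_zpow_mul_zpow_mul_zpow_of_mem_closure hba hca hcb (mul_mem hx (inv_mem hy))
  have hf : f (c ^ p * a ^ m * b ^ n) = 1 := by rw [← h, map_mul, map_inv, hxy, mul_inv_cancel]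
  have hψ := congrArg (Units.val) hf
  simp only [map_mul, map_zpow, Units.val_mul, Units.val_one, coe_zpow_eq_heisenbergPsi hfa,
    coe_zpow_eq_heisenbergPsi hfb, coe_zpow_eq_heisenbergPsi hfc, heisenbergPsi_mul] at hψ
  obtain ⟨hz, ht⟩ := heisenbergPsi_eq_one hψ
  obtain ⟨rfl, rfl⟩ := hindep m n (by simpa using hz)
  have hp : p = 0 := by simpa [hs] using ht
  subst hp
  exact mul_inv_eq_one.mp (by simpa using h)
end

section
/- Let p be an odd prime and d a natural number. If there exists an injective group homomorphism from the cyclic group of order p into GL(d, ℤ), then p − 1 ≤ d. -/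
open Matrix

/-- A nontrivial rational matrix of prime order `p` has size at least `p - 1`. -/
theorem Matrix.sub_one_le_card_of_pow_prime_eq_one {n : Type*} [Fintype n] [DecidableEq n]
    {p : ℕ} (hp : p.Prime) {A : Matrix n n ℚ} (hA : A ^ p = 1) (hne : A ≠ 1) :
    p - 1 ≤ Fintype.card n := by
  have := Fact.mk hp
  have hdvd : minpoly ℚ A ∣ Polynomial.cyclotomic p ℚ * (Polynomial.X - 1) := by
    rw [Polynomial.cyclotomic_prime_mul_X_sub_one]
    exact minpoly.dvd ℚ A (by simp [hA])
  have hcyc : Polynomial.cyclotomic p ℚ ∣ minpoly ℚ A := by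
    by_contra h
    have hcop : IsCoprime (Polynomial.cyclotomic p ℚ) (minpoly ℚ A) :=
      (Polynomial.cyclotomic.irreducible_rat hp.pos).coprime_iff_not_dvd.mpr h
    have hroot := Polynomial.aeval_eq_zero_of_dvd_aeval_eq_zero
      (hcop.symm.dvd_of_dvd_mul_left hdvd) (minpoly.aeval ℚ A)
    exact hne (sub_eq_zero.mp (by simpa using hroot))
  have hdeg := Polynomial.natDegree_le_of_dvd (hcyc.trans (Matrix.minpoly_dvd_charpoly A))
    A.charpoly_monic.ne_zero
  rwa [Polynomial.natDegree_cyclotomic, Nat.totient_prime hp,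
    Matrix.charpoly_natDegree_eq_dim] at hdeg

theorem stmt17 (p : ℕ) (hp : p.Prime) (hodd : Odd p) (d : ℕ)
    (f : Multiplicative (ZMod p) →* GL (Fin d) ℤ) (hf : Function.Injective f) :
    p - 1 ≤ d := by
  have := Fact.mk hp
  let φ : Matrix (Fin d) (Fin d) ℤ →+* Matrix (Fin d) (Fin d) ℚ := (Int.castRingHom ℚ).mapMatrix
  have hφ : Function.Injective φ := Matrix.map_injective Int.cast_injective
  let g : Multiplicative (ZMod p) := Multiplicative.ofAdd 1
  have hg : g ^ p = 1 := by
    rw [← ofAdd_nsmul]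
    simp
  have hg1 : g ≠ 1 := fun h => one_ne_zero (α := ZMod p) (Multiplicative.ofAdd.injective h)
  have hpow : φ (f g) ^ p = 1 := by
    rw [← map_pow, ← Units.val_pow_eq_pow_val, ← map_pow, hg, map_one, Units.val_one, map_one]
  have hne : φ (f g) ≠ 1 := fun h =>
    hg1 (hf ((Units.ext (hφ (h.trans (map_one φ).symm))).trans (map_one f).symm))
  simpa using Matrix.sub_one_le_card_of_pow_prime_eq_one hp hpow hne
end
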